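/- arXiv:1509.02829 — 2 statements merged into one kernel-verified Lean document; each statement's English description precedes it below -/
import Mathlib

section
/- Let f : [0,1] → ℝ₊ be continuous with f(0)=f(1)=0 satisfying (H_f). For every n ≥ 1 let θ_n be a noncrossing tree with n vertices and τ_n its shape. Assume that H(τ_n)/n → 0 and that there is a sequence B_n → ∞ such that sup_{s∈[0,1]} |W_{⌊ns⌋}(τ_n)/B_n − f(s)| → 0 as n → ∞. Then θ_n, viewed as compact subsets of the closed unit disk, converge to L(f) for the Hausdorff distance. -/
open Filter Set

noncomputable section

/-- The position `e^{-2iπk/n}` of the `k`-th among the `n`-th roots of unity,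
labelled in clockwise order starting from the complex number `1`. -/
def ncPos (n k : ℕ) : ℂ := Complex.exp (-(2 * Real.pi * Complex.I) * k / n)

/-- A noncrossing tree with `n` vertices: a tree on the vertex set of `n`-th roots of unity
whose edges, drawn as straight line segments, pairwise intersect only at common endpoints. -/
structure NCTree (n : ℕ) where
  adj : SimpleGraph (Fin n)
  isTree : adj.IsTree
  noncrossing : ∀ a b c d : Fin n, adj.Adj a b → adj.Adj c d →
    ({(a : ℕ), (b : ℕ)} : Set ℕ) ≠ {(c : ℕ), (d : ℕ)} →
    segment ℝ (ncPos n a) (ncPos n b) ∩ segment ℝ (ncPos n c) (ncPos n d) ⊆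
      {z : ℂ | (z = ncPos n a ∨ z = ncPos n b) ∧ (z = ncPos n c ∨ z = ncPos n d)}

/-- A plane tree in Neveu's formalism: a finite set of finite words of positive integers,
containing the root `[]`, closed under prefixes, and such that the children of a vertex `u`
are `u1, …, u k_u`. -/
structure PlaneTree where
  verts : Finset (List ℕ)
  root_mem : [] ∈ verts
  prefix_closed : ∀ u v : List ℕ, u <+: v → v ∈ verts → u ∈ verts
  labels_pos : ∀ u ∈ verts, ∀ i ∈ u, 1 ≤ i
  children_closed : ∀ (u : List ℕ) (i : ℕ), 1 ≤ i → u ++ [i + 1] ∈ verts → u ++ [i] ∈ verts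

namespace PlaneTree

/-- The number of children of the vertex `u` in `τ`. -/
def kc (τ : PlaneTree) (u : List ℕ) : ℕ := Set.ncard {i : ℕ | u ++ [i] ∈ τ.verts}

/-- The number of strict descendants of `u` in `τ`. -/
def descCount (τ : PlaneTree) (u : List ℕ) : ℕ :=
  Set.ncard {v : List ℕ | v ∈ τ.verts ∧ u <+: v ∧ v ≠ u}

/-- The number of vertices of the subtree grafted on `u` (that is, `u` and its descendants). -/
def subtreeSize (τ : PlaneTree) (u : List ℕ) : ℕ :=
  Set.ncard {v : List ℕ | v ∈ τ.verts ∧ u <+: v}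

/-- The height of `τ`: the maximal generation of a vertex. -/
def height (τ : PlaneTree) : ℕ := τ.verts.sup List.length

/-- The `j`-th vertex of `τ` in lexicographical order (starting from `j = 0` for the root). -/
def lexVertex (τ : PlaneTree) (j : ℕ) : List ℕ := (τ.verts.sort (· ≤ ·)).getD j []

/-- The Łukasiewicz path of `τ`: `W 0 = 0` and `W (j+1) = W j + k_{u(j)} - 1`, the vertices
being listed in lexicographical order. -/
def lukas (τ : PlaneTree) (j : ℕ) : ℤ :=
  (((τ.verts.sort (· ≤ ·)).take j).map fun u => (τ.kc u : ℤ) - 1).sum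

end PlaneTree

/-- `IsShape n θ τ f` expresses that the plane tree `τ` is the shape of the noncrossing tree
`θ`, the correspondence between the vertices of `τ` and those of `θ` being given by `f`:
`f` is a bijection sending the root of `τ` to the vertex `1` of `θ`, sending parent-child
pairs exactly to edges of `θ`, and the planar (clockwise, starting from the parent) order of
the children of each vertex agrees with their order in `τ`. -/
def IsShape (n : ℕ) (θ : NCTree n) (τ : PlaneTree) (f : List ℕ → Fin n) : Prop :=
  τ.verts.card = n ∧
  Set.BijOn f (↑τ.verts) Set.univ ∧
  (f ([] : List ℕ)).val = 0 ∧
  (∀ u ∈ τ.verts, u ≠ [] → θ.adj.Adj (f u.dropLast) (f u)) ∧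
  (∀ u ∈ τ.verts, ∀ v ∈ τ.verts, θ.adj.Adj (f u) (f v) → u = v.dropLast ∨ v = u.dropLast) ∧
  (∀ u ∈ τ.verts, ∀ i j : ℕ, 1 ≤ i → i < j → u ++ [j] ∈ τ.verts →
    f (u ++ [i]) - f u.dropLast < f (u ++ [j]) - f u.dropLast)

/-- `leftOf z w` : the point `w` lies in the (open) left half-plane bounded by the oriented
line from `z` to the complex number `1`. -/
def leftOf (z w : ℂ) : Prop := 0 < ((starRingEnd ℂ) (1 - z) * (w - z)).im

/-- The number of children of the vertex of `θ` corresponding to the vertex `u` of its shape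
`τ` which lie to the left of it (in the left half-plane bounded by the line joining it to the
complex number `1`). -/
def leftCount (n : ℕ) (θ : NCTree n) (τ : PlaneTree) (f : List ℕ → Fin n) (u : List ℕ) : ℕ :=
  Set.ncard {i : ℕ | u ++ [i] ∈ τ.verts ∧ leftOf (ncPos n (f u)) (ncPos n (f (u ++ [i])))}

/-- The degree of the vertex `v` in the noncrossing tree `θ`. -/
def ncDeg (n : ℕ) (θ : NCTree n) (v : Fin n) : ℕ := Set.ncard {w : Fin n | θ.adj.Adj v w}

/-- The noncrossing tree `θ` viewed as the compact subset of the closed unit disk given by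
the union of its edges. -/
def ncSet (n : ℕ) (θ : NCTree n) : Set ℂ :=
  ⋃ (a : Fin n) (b : Fin n) (_ : θ.adj.Adj a b), segment ℝ (ncPos n a) (ncPos n b)


/-- The point `e^{-2iπs}` of the unit circle. -/
def cpt (s : ℝ) : ℂ := Complex.exp (-(2 * Real.pi * Complex.I) * s)

/-- The chord `[e^{-2iπs}, e^{-2iπt}]` of the closed unit disk. -/
def chord (s t : ℝ) : Set ℂ := segment ℝ (cpt s) (cpt t)

/-- The relation `s ∼_f t` : `f(s) = f(t) = min_{[s∧t, s∨t]} f`. -/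
def relF (f : ℝ → ℝ) (s t : ℝ) : Prop :=
  f s = f t ∧ f s = sInf (f '' Set.Icc (min s t) (max s t))

/-- The lamination `L(f) = ⋃_{s ∼_f t} [e^{-2iπs}, e^{-2iπt}]` coded by the continuous
function `f`. -/
def lamF (f : ℝ → ℝ) : Set ℂ :=
  ⋃ (p : ℝ × ℝ) (_ : p.1 ∈ Set.Icc (0 : ℝ) 1 ∧ p.2 ∈ Set.Icc (0 : ℝ) 1 ∧ relF f p.1 p.2),
    chord p.1 p.2

/-! ### Words -/

lemma word_lt_of_decomp (w : List ℕ) {i j : ℕ} (u v : List ℕ) (h : i < j) :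
    w ++ i :: u < w ++ j :: v := by
  induction w with
  | nil => simpa [List.cons_lt_cons_iff] using Or.inl h
  | cons a w ih => simpa [List.cons_lt_cons_iff] using ih

lemma word_lt_decomp : ∀ (u v : List ℕ), u < v → u <+: v ∨
    ∃ (w : List ℕ) (i j : ℕ) (u' v' : List ℕ), i < j ∧ u = w ++ i :: u' ∧ v = w ++ j :: v'
  | [], v, _ => Or.inl (List.nil_prefix)
  | a :: u, [], h => by simp at h
  | a :: u, b :: v, h => by
    rw [List.cons_lt_cons_iff] at h
    rcases h with h | ⟨rfl, h⟩
    · exact Or.inr ⟨[], a, b, u, v, h, rfl, rfl⟩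
    · rcases word_lt_decomp u v h with h | ⟨w, i, j, u', v', hij, rfl, rfl⟩
      · left; simpa [List.cons_prefix_cons] using h
      · exact Or.inr ⟨a :: w, i, j, u', v', hij, rfl, rfl⟩

lemma word_prefix_le {u v : List ℕ} (h : u <+: v) : u ≤ v := by
  by_contra hc
  have hlt : v < u := lt_of_not_ge hc
  rcases word_lt_decomp v u hlt with h' | ⟨w, i, j, u', v', hij, rfl, rfl⟩
  · have := h.eq_of_length_le h'.length_le
    exact absurd hlt (by rw [this]; exact lt_irrefl _)
  · obtain ⟨t, ht⟩ := h
    simp at ht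
    omega

lemma word_prefix_lt {u v : List ℕ} (h : u <+: v) (hne : u ≠ v) : u < v :=
  lt_of_le_of_ne (word_prefix_le h) hne

lemma word_after {u x y : List ℕ} (hx : u <+: x) (hy : u < y) (hn : ¬ u <+: y) : x < y := by
  rcases word_lt_decomp u y hy with h' | ⟨w, i, j, u', v', hij, rfl, rfl⟩
  · exact absurd h' hn
  · obtain ⟨t, rfl⟩ := hx
    rw [List.append_assoc]
    exact word_lt_of_decomp w _ _ hij

lemma word_lt_concat (u : List ℕ) (i : ℕ) : u < u ++ [i] :=
  word_prefix_lt ⟨[i], rfl⟩ (by simp)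

namespace PlaneTree

/-- children of a set of vertices -/
def chil (τ : PlaneTree) (A : Finset (List ℕ)) : Finset (List ℕ) :=
  τ.verts.filter (fun v => v ≠ [] ∧ v.dropLast ∈ A)

/-- strict lexicographic predecessors -/
def low (τ : PlaneTree) (u : List ℕ) : Finset (List ℕ) := τ.verts.filter (fun v => v < u)

/-- descendants (including the vertex) -/
def des (τ : PlaneTree) (u : List ℕ) : Finset (List ℕ) := τ.verts.filter (fun v => u <+: v)

def upp (τ : PlaneTree) (u : List ℕ) : Finset (List ℕ) :=
  τ.verts.filter (fun v => v < u ∨ u <+: v)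

def idx (τ : PlaneTree) (u : List ℕ) : ℕ := (τ.low u).card

def fin (τ : PlaneTree) (u : List ℕ) : ℕ := (τ.upp u).card

variable (τ : PlaneTree)

lemma kc_eq (u : List ℕ) : τ.kc u = (τ.verts.filter (fun v => v ≠ [] ∧ v.dropLast = u)).card := by
  unfold kc
  rw [← Set.ncard_coe_finset]
  have : ((τ.verts.filter (fun v => v ≠ [] ∧ v.dropLast = u) : Finset (List ℕ)) : Set (List ℕ))
      = (fun i => u ++ [i]) '' {i : ℕ | u ++ [i] ∈ τ.verts} := by
    ext v
    simp only [Finset.coe_filter, Set.mem_ofPred_eq, Set.mem_image]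
    constructor
    · rintro ⟨hv, hne, rfl⟩
      refine ⟨v.getLast hne, ?_, ?_⟩ <;> simp [List.dropLast_append_getLast, hv]
    · rintro ⟨i, hi, rfl⟩
      simp [hi]
  rw [this, Set.ncard_image_of_injective]
  intro i j h
  simpa using h

lemma sum_kc (A : Finset (List ℕ)) : ∑ u ∈ A, τ.kc u = (τ.chil A).card := by
  have := Finset.sum_card_fiberwise_eq_card_filter (τ.verts.filter (fun v => v ≠ [])) A
    List.dropLast
  simp only [Finset.filter_filter] at this
  rw [chil, ← this]
  exact Finset.sum_congr rfl fun u _ => τ.kc_eq u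

lemma lukas_lower (A : Finset (List ℕ)) (hA : A ⊆ τ.verts)
    (hlow : ∀ x ∈ A, ∀ y ∈ τ.verts, y < x → y ∈ A) :
    τ.lukas A.card = ((τ.chil A).card : ℤ) - A.card := by
  have key : τ.verts.sort (· ≤ ·) = A.sort (· ≤ ·) ++ (τ.verts \ A).sort (· ≤ ·) := by
    apply List.Perm.eq_of_pairwise (le := (· ≤ ·))
    · intro a b _ _ h1 h2; exact le_antisymm h1 h2
    · exact Finset.pairwise_sort _ _
    · rw [List.pairwise_append]
      refine ⟨Finset.pairwise_sort _ _, Finset.pairwise_sort _ _, ?_⟩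
      intro a ha b hb
      simp only [Finset.mem_sort, Finset.mem_sdiff] at ha hb
      by_contra hc
      exact hb.2 (hlow a ha b hb.1 (lt_of_not_ge hc))
    · apply List.perm_of_nodup_nodup_toFinset_eq
      · exact Finset.sort_nodup _ _
      · rw [List.nodup_append]
        refine ⟨Finset.sort_nodup _ _, Finset.sort_nodup _ _, ?_⟩
        intro a ha b hb
        simp only [Finset.mem_sort, Finset.mem_sdiff] at ha hb
        rintro rfl
        exact hb.2 ha
      · ext x
        simp only [List.mem_toFinset, Finset.mem_sort, List.mem_append, Finset.mem_sdiff]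
        constructor
        · intro h; by_cases h' : x ∈ A <;> simp [h, h']
        · rintro (h | h)
          exacts [hA h, h.1]
  unfold lukas
  rw [key, List.take_left' (by simp)]
  have : ((A.sort (· ≤ ·)).map fun u => (τ.kc u : ℤ) - 1).sum = ∑ u ∈ A, ((τ.kc u : ℤ) - 1) := by
    rw [Finset.sum_eq_multiset_sum, ← Finset.sort_eq A (· ≤ ·), Multiset.map_coe, Multiset.sum_coe]
  rw [this, Finset.sum_sub_distrib]
  simp [← sum_kc]

variable {τ}

lemma mem_low {u v : List ℕ} : v ∈ τ.low u ↔ v ∈ τ.verts ∧ v < u := by simp [low]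
lemma mem_des {u v : List ℕ} : v ∈ τ.des u ↔ v ∈ τ.verts ∧ u <+: v := by simp [des]
lemma mem_upp {u v : List ℕ} : v ∈ τ.upp u ↔ v ∈ τ.verts ∧ (v < u ∨ u <+: v) := by simp [upp]
lemma mem_chil {A : Finset (List ℕ)} {v : List ℕ} :
    v ∈ τ.chil A ↔ v ∈ τ.verts ∧ v ≠ [] ∧ v.dropLast ∈ A := by simp [chil]

lemma lukas_idx (u : List ℕ) : τ.lukas (τ.idx u) = ((τ.chil (τ.low u)).card : ℤ) - τ.idx u := by
  refine τ.lukas_lower _ (Finset.filter_subset _ _) ?_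
  intro x hx y hy hyx
  rw [mem_low] at *
  exact ⟨hy, hyx.trans hx.2⟩

lemma lukas_fin (u : List ℕ) : τ.lukas (τ.fin u) = ((τ.chil (τ.upp u)).card : ℤ) - τ.fin u := by
  refine τ.lukas_lower _ (Finset.filter_subset _ _) ?_
  intro x hx y hy hyx
  rw [mem_upp] at *
  refine ⟨hy, ?_⟩
  rcases hx.2 with h | h
  · exact Or.inl (hyx.trans h)
  · by_cases hu : u <+: y
    · exact Or.inr hu
    · left
      rcases lt_trichotomy y u with h1 | rfl | h1
      · exact h1
      · simp at hu
      · exact absurd (hyx.trans (word_after h h1 hu)) (lt_irrefl _)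

/-- difference of the number of children -/
lemma chil_sub {A A' : Finset (List ℕ)} (h : A ⊆ A') :
    (τ.chil A').card = (τ.chil A).card + (τ.chil (A' \ A)).card := by
  rw [← Finset.card_union_of_disjoint]
  · congr 1
    ext v
    simp only [Finset.mem_union, mem_chil, Finset.mem_sdiff]
    have := @h v.dropLast
    tauto
  · rw [Finset.disjoint_left]
    intro v
    simp only [mem_chil, Finset.mem_sdiff]
    tauto

lemma dropLast_mem {v : List ℕ} (hv : v ∈ τ.verts) : v.dropLast ∈ τ.verts :=
  τ.prefix_closed _ _ (List.dropLast_prefix v) hv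

lemma dropLast_lt {v : List ℕ} (hv : v ≠ []) : v.dropLast < v :=
  word_prefix_lt (List.dropLast_prefix v) (fun h => by
    have h1 := congrArg List.length h
    have := List.length_pos_iff.2 hv
    simp at h1; omega)

lemma prefix_dropLast {u v : List ℕ} (h : u <+: v) (hne : u ≠ v) : u <+: v.dropLast := by
  rcases List.eq_nil_or_concat v with rfl | ⟨l, b, rfl⟩
  · simp at h; exact absurd h hne
  · rw [List.concat_eq_append] at *
    rw [List.dropLast_concat]
    rcases List.prefix_concat_iff.1 h with h | h
    · exact absurd h hne
    · exact h

lemma idx_add_card {u : List ℕ} {A' : Finset (List ℕ)} (h : τ.low u ⊆ A') :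
    A'.card = τ.idx u + (A' \ τ.low u).card := by
  rw [Finset.card_sdiff_of_subset h]; have := Finset.card_le_card h; unfold idx; omega

lemma low_subset_upp (u : List ℕ) : τ.low u ⊆ τ.upp u := by
  intro v hv; rw [mem_upp]; rw [mem_low] at hv; tauto

lemma upp_sdiff_low (u : List ℕ) : τ.upp u \ τ.low u = τ.des u := by
  ext v
  simp only [Finset.mem_sdiff, mem_upp, mem_low, mem_des]
  constructor
  · tauto
  · rintro ⟨h1, h2⟩
    have := word_prefix_le h2
    exact ⟨⟨h1, Or.inr h2⟩, fun h => absurd (this.trans_lt h.2) (lt_irrefl _)⟩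

lemma fin_eq (u : List ℕ) : τ.fin u = τ.idx u + (τ.des u).card := by
  rw [← upp_sdiff_low]; exact idx_add_card (low_subset_upp u)

lemma lukas_fin_eq {u : List ℕ} (hu : u ∈ τ.verts) :
    τ.lukas (τ.fin u) = τ.lukas (τ.idx u) - 1 := by
  rw [lukas_fin, lukas_idx, chil_sub (low_subset_upp u), upp_sdiff_low, fin_eq]
  have : τ.chil (τ.des u) = (τ.des u).erase u := by
    ext v
    simp only [mem_chil, mem_des, Finset.mem_erase]
    constructor
    · rintro ⟨h1, h2, _, h4⟩
      refine ⟨?_, h1, h4.trans (List.dropLast_prefix v)⟩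
      rintro rfl
      exact absurd ((dropLast_lt h2).trans_le (word_prefix_le h4)) (lt_irrefl _)
    · rintro ⟨h1, h2, h3⟩
      refine ⟨h2, ?_, dropLast_mem h2, prefix_dropLast h3 (Ne.symm h1)⟩
      rintro rfl
      simp at h3; exact h1 h3.symm
  have hm : u ∈ τ.des u := by rw [mem_des]; exact ⟨hu, List.prefix_refl u⟩
  have hp := Finset.card_pos.2 ⟨u, hm⟩
  rw [this, Finset.card_erase_of_mem hm]
  push_cast [Nat.cast_sub hp]
  ring

lemma low_mono {u x : List ℕ} (h : u ≤ x) : τ.low u ⊆ τ.low x := by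
  intro v hv; rw [mem_low] at *; exact ⟨hv.1, hv.2.trans_le h⟩

lemma idx_mono {u x : List ℕ} (h : u ≤ x) : τ.idx u ≤ τ.idx x := Finset.card_le_card (low_mono h)

lemma idx_lt {u x : List ℕ} (hu : u ∈ τ.verts) (h : u < x) : τ.idx u < τ.idx x := by
  apply Finset.card_lt_card
  refine ⟨low_mono h.le, fun hc => ?_⟩
  have : u ∈ τ.low u := hc (by rw [mem_low]; exact ⟨hu, h⟩)
  rw [mem_low] at this
  exact lt_irrefl _ this.2

lemma lukas_des_ge {u x : List ℕ} (hx : x ∈ τ.verts) (h : u <+: x) :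
    τ.lukas (τ.idx u) ≤ τ.lukas (τ.idx x) := by
  by_cases hux : u = x
  · rw [hux]
  have hsub := low_mono (τ := τ) (word_prefix_le h)
  rw [lukas_idx, lukas_idx, chil_sub hsub]
  have e := idx_add_card hsub
  change τ.idx x = _ at e
  rw [e]
  have hu : u ∈ τ.verts := τ.prefix_closed _ _ h hx
  have hlt := word_prefix_lt h hux
  set E := τ.low x \ τ.low u with hE
  have mE : ∀ v, v ∈ E ↔ v ∈ τ.verts ∧ u ≤ v ∧ v < x := by
    intro v; simp only [hE, Finset.mem_sdiff, mem_low]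
    rw [← not_lt]; tauto
  have pE : ∀ v ∈ E, u <+: v := by
    intro v hv
    rw [mE] at hv
    by_contra hn
    have h1 : u < v := lt_of_le_of_ne hv.2.1 (by rintro rfl; simp at hn)
    exact absurd ((word_after h h1 hn).trans hv.2.2) (lt_irrefl _)
  have huE : u ∈ E := by rw [mE]; exact ⟨hu, le_rfl, hlt⟩
  have hxE : x ∉ E.erase u := by simp [mE]
  have hsub2 : insert x (E.erase u) ⊆ τ.chil E := by
    intro v hv
    have aux : ∀ v, v ∈ τ.verts → u <+: v → u ≠ v → v ≤ x → v ∈ τ.chil E := by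
      intro v h1 h2 h3 h4
      have hne : v ≠ [] := by rintro rfl; simp at h2; exact h3 h2
      rw [mem_chil, mE]
      exact ⟨h1, hne, dropLast_mem h1, word_prefix_le (prefix_dropLast h2 h3),
        (dropLast_lt hne).trans_le h4⟩
    rw [Finset.mem_insert, Finset.mem_erase] at hv
    rcases hv with rfl | ⟨h1, h2⟩
    · exact aux _ hx h hux le_rfl
    · exact aux _ ((mE v).1 h2).1 (pE v h2) (Ne.symm h1) ((mE v).1 h2).2.2.le
  have hc := Finset.card_le_card hsub2
  rw [Finset.card_insert_of_notMem hxE, Finset.card_erase_of_mem huE] at hc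
  have hp := Finset.card_pos.2 ⟨u, huE⟩
  push_cast
  omega

/-- Value of the path at a child. -/
lemma lukas_child {u : List ℕ} {i : ℕ} (hx : u ++ [i] ∈ τ.verts) :
    τ.lukas (τ.idx (u ++ [i])) = τ.lukas (τ.idx u)
      + (τ.verts.filter (fun v => v ≠ [] ∧ v.dropLast = u ∧ u ++ [i] ≤ v)).card - 1 := by
  have h : u <+: u ++ [i] := ⟨_, rfl⟩
  have hsub := low_mono (τ := τ) (word_prefix_le h)
  rw [lukas_idx, lukas_idx, chil_sub hsub]
  have e := idx_add_card hsub
  change τ.idx _ = _ at e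
  rw [e]
  have hu : u ∈ τ.verts := τ.prefix_closed _ _ h hx
  have hlt := word_lt_concat u i
  set x := u ++ [i] with hxdef
  set E := τ.low x \ τ.low u with hE
  have mE : ∀ v, v ∈ E ↔ v ∈ τ.verts ∧ u ≤ v ∧ v < x := by
    intro v; simp only [hE, Finset.mem_sdiff, mem_low]
    rw [← not_lt]; tauto
  have pE : ∀ v, u ≤ v → v < x → u <+: v := by
    intro v hv1 hv2
    by_contra hn
    have h1 : u < v := lt_of_le_of_ne hv1 (by rintro rfl; simp at hn)
    exact absurd ((word_after h h1 hn).trans hv2) (lt_irrefl _)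
  have huE : u ∈ E := by rw [mE]; exact ⟨hu, le_rfl, hlt⟩
  set F := τ.verts.filter (fun v => v ≠ [] ∧ v.dropLast = u ∧ x ≤ v) with hF
  have hdis : Disjoint (E.erase u) F := by
    rw [Finset.disjoint_left]
    intro v h1 h2
    simp only [Finset.mem_erase, mE, hF, Finset.mem_filter] at h1 h2
    exact absurd (h1.2.2.2.trans_le h2.2.2.2) (lt_irrefl _)
  have heq : τ.chil E = E.erase u ∪ F := by
    ext v
    simp only [Finset.mem_union, Finset.mem_erase, mE, hF, Finset.mem_filter, mem_chil]
    constructor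
    · rintro ⟨h1, h2, h3, h4, h5⟩
      by_cases hvx : v < x
      · left
        have := h4.trans_lt (dropLast_lt h2)
        exact ⟨this.ne', h1, this.le, hvx⟩
      · right
        refine ⟨h1, h2, ?_, not_lt.1 hvx⟩
        by_contra hne
        have p1 := pE _ h4 h5
        rcases word_lt_decomp _ _ h5 with p2 | ⟨w, a, b, u', v', hab, e1, e2⟩
        · rcases List.prefix_concat_iff.1 p2 with p3 | p3
          · rw [p3] at h5; exact absurd h5 (lt_irrefl _)
          · exact hne ((p3.eq_of_length_le p1.length_le))
        · apply hvx
          rw [e2, ← List.dropLast_append_getLast h2, e1, List.append_assoc]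
          exact word_lt_of_decomp w _ _ hab
    · rintro (⟨h1, h2, h3, h4⟩ | ⟨h1, h2, h3, h4⟩)
      · have hp := pE v h3 h4
        have hne : v ≠ [] := by rintro rfl; simp at hp; exact h1 hp.symm
        exact ⟨h2, hne, dropLast_mem h2, word_prefix_le (prefix_dropLast hp (Ne.symm h1)),
          (dropLast_lt hne).trans h4⟩
      · rw [h3]; exact ⟨h1, h2, hu, le_rfl, hlt⟩
  rw [heq, Finset.card_union_of_disjoint hdis, Finset.card_erase_of_mem huE]
  have hp := Finset.card_pos.2 ⟨u, huE⟩
  push_cast [Nat.cast_sub hp]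
  ring

lemma idx_succ {u x : List ℕ} (hu : u ∈ τ.verts) (h : u < x)
    (hno : ∀ v ∈ τ.verts, u < v → x ≤ v) : τ.idx x = τ.idx u + 1 := by
  unfold idx
  have : τ.low x = insert u (τ.low u) := by
    ext v
    simp only [Finset.mem_insert, mem_low]
    constructor
    · rintro ⟨h1, h2⟩
      rcases lt_trichotomy v u with h3 | h3 | h3
      · exact Or.inr ⟨h1, h3⟩
      · exact Or.inl h3
      · exact absurd (h2.trans_le (hno v h1 h3)) (lt_irrefl _)
    · rintro (rfl | ⟨h1, h2⟩)
      · exact ⟨hu, h⟩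
      · exact ⟨h1, h2.trans h⟩
  rw [this, Finset.card_insert_of_notMem (by simp [mem_low])]

lemma lukas_succ {u : List ℕ} (hu : u ∈ τ.verts) :
    τ.lukas (τ.idx u + 1) = τ.lukas (τ.idx u) + τ.kc u - 1 := by
  have hc : (insert u (τ.low u)).card = τ.idx u + 1 := by
    rw [Finset.card_insert_of_notMem (by simp [mem_low])]; rfl
  have hs : insert u (τ.low u) ⊆ τ.verts := by
    intro v hv
    rw [Finset.mem_insert, mem_low] at hv
    rcases hv with rfl | hv
    exacts [hu, hv.1]
  have := τ.lukas_lower (insert u (τ.low u)) hs (by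
    intro x hx y hy hyx
    rw [Finset.mem_insert, mem_low] at *
    rcases hx with rfl | hx
    · exact Or.inr ⟨hy, hyx⟩
    · exact Or.inr ⟨hy, hyx.trans hx.2⟩)
  rw [hc] at this
  rw [this, lukas_idx, ← τ.sum_kc, ← τ.sum_kc, Finset.sum_insert (by simp [mem_low])]
  push_cast
  ring

lemma idx_surj {j : ℕ} (hj : j < τ.verts.card) : ∃ x ∈ τ.verts, τ.idx x = j := by
  have := Finset.surjOn_of_injOn_of_card_le (s := τ.verts) (t := Finset.range τ.verts.card) τ.idx
    ?_ ?_ (by simp)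
  · obtain ⟨x, hx, h⟩ := this (by simpa using hj : j ∈ ((Finset.range τ.verts.card : Finset ℕ) : Set ℕ))
    exact ⟨x, hx, h⟩
  · intro x hx
    simp only [Finset.coe_range, Set.mem_Iio]
    apply Finset.card_lt_card
    refine ⟨Finset.filter_subset _ _, fun hc => ?_⟩
    have := hc hx
    rw [mem_low] at this
    exact lt_irrefl _ this.2
  · intro x hx y hy h
    rcases lt_trichotomy x y with h3 | h3 | h3
    · exact absurd h (idx_lt hx h3).ne
    · exact h3
    · exact absurd h (idx_lt hy h3).ne'

lemma lukas_child_le {u : List ℕ} {i : ℕ} (hx : u ++ [i] ∈ τ.verts) :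
    τ.lukas (τ.idx (u ++ [i])) ≤ τ.lukas (τ.idx u + 1) := by
  rw [lukas_child hx, lukas_succ (τ.prefix_closed _ _ ⟨_, rfl⟩ hx), kc_eq]
  have : (τ.verts.filter (fun v => v ≠ [] ∧ v.dropLast = u ∧ u ++ [i] ≤ v)).card ≤
      (τ.verts.filter (fun v => v ≠ [] ∧ v.dropLast = u)).card := by
    apply Finset.card_le_card
    intro v
    simp only [Finset.mem_filter]
    tauto
  omega

/-- If the path is strictly higher at a child, there is a right sibling. -/
lemma right_sibling {u : List ℕ} {i : ℕ} (hx : u ++ [i] ∈ τ.verts)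
    (h : τ.lukas (τ.idx u) < τ.lukas (τ.idx (u ++ [i]))) :
    ∃ j, i < j ∧ u ++ [j] ∈ τ.verts := by
  rw [lukas_child hx] at h
  have h2 : 1 < (τ.verts.filter (fun v => v ≠ [] ∧ v.dropLast = u ∧ u ++ [i] ≤ v)).card := by
    omega
  obtain ⟨v, hv, hne⟩ := Finset.exists_mem_ne h2 (u ++ [i])
  rw [Finset.mem_filter] at hv
  obtain ⟨h3, h4, rfl, h6⟩ := hv
  have h7 := lt_of_le_of_ne h6 (Ne.symm hne)
  refine ⟨v.getLast h4, ?_, by rw [List.dropLast_append_getLast]; exact h3⟩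
  by_contra hc
  rcases (not_lt.1 hc).lt_or_eq with h8 | h8
  · have := word_lt_of_decomp v.dropLast [] [] h8
    rw [List.dropLast_append_getLast] at this
    exact absurd (this.trans h7) (lt_irrefl _)
  · rw [← h8, List.dropLast_append_getLast] at h7
    exact lt_irrefl _ h7

lemma fin_le_card (u : List ℕ) : τ.fin u ≤ τ.verts.card :=
  Finset.card_le_card (Finset.filter_subset _ _)

lemma idx_lt_fin {u : List ℕ} (hu : u ∈ τ.verts) : τ.idx u < τ.fin u := by
  rw [fin_eq]
  have : 0 < (τ.des u).card := Finset.card_pos.2 ⟨u, mem_des.2 ⟨hu, List.prefix_refl u⟩⟩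
  omega

/-- The path stays above its value at `u` on the subtree of `u`. -/
lemma lukas_ge {u : List ℕ} {j : ℕ} (h1 : τ.idx u ≤ j) (h2 : j < τ.fin u) :
    τ.lukas (τ.idx u) ≤ τ.lukas j := by
  obtain ⟨x, hx, rfl⟩ := idx_surj (h2.trans_le (fin_le_card u))
  apply lukas_des_ge hx
  by_contra hn
  rcases lt_trichotomy x u with h3 | h3 | h3
  · have := idx_lt hx h3; omega
  · rw [h3] at hn; simp at hn
  · have : τ.fin u ≤ τ.idx x := by
      apply Finset.card_le_card
      intro v hv
      rw [mem_upp] at hv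
      rw [mem_low]
      refine ⟨hv.1, ?_⟩
      rcases hv.2 with h | h
      · exact h.trans h3
      · exact word_after h h3 hn
    omega

/-- all descendants come before something later -/
lemma fin_le_idx {u x : List ℕ} (h : u < x) (hn : ¬ u <+: x) : τ.fin u ≤ τ.idx x := by
  apply Finset.card_le_card
  intro v hv
  rw [mem_upp] at hv
  rw [mem_low]
  refine ⟨hv.1, ?_⟩
  rcases hv.2 with h' | h'
  · exact h'.trans h
  · exact word_after h' h hn

lemma fin_mono {u x : List ℕ} (h : u <+: x) : τ.fin x ≤ τ.fin u := by
  apply Finset.card_le_card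
  intro v hv
  rw [mem_upp] at *
  refine ⟨hv.1, ?_⟩
  rcases hv.2 with h' | h'
  · by_cases hp : u <+: v
    · exact Or.inr hp
    · left
      by_contra hc
      have h3 : u < v := lt_of_le_of_ne (not_lt.1 hc) (by rintro rfl; simp at hp)
      exact absurd ((word_after h h3 hp).trans h') (lt_irrefl _)
  · exact Or.inr (h.trans h')

lemma length_le_height {u : List ℕ} (hu : u ∈ τ.verts) : u.length ≤ τ.height :=
  Finset.le_sup (f := List.length) hu

lemma child_of_le {u : List ℕ} {i j : ℕ} (h1 : 1 ≤ i) (hij : i ≤ j) (h : u ++ [j] ∈ τ.verts) :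
    u ++ [i] ∈ τ.verts := by
  induction j, hij using Nat.le_induction with
  | base => exact h
  | succ k hk ih => exact ih (τ.children_closed u k (h1.trans hk) h)

end PlaneTree

/-! ### Geometry of crossing chords -/

lemma ncPos_re (n k : ℕ) : (ncPos n k).re = Real.cos (2 * Real.pi * k / n) := by
  have : (-(2 * Real.pi * Complex.I) * k / n : ℂ) = ((-(2 * Real.pi * k / n) : ℝ) : ℂ) * Complex.I := by
    push_cast; ring
  rw [ncPos, this, Complex.exp_ofReal_mul_I_re, Real.cos_neg]

lemma ncPos_im (n k : ℕ) : (ncPos n k).im = - Real.sin (2 * Real.pi * k / n) := by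
  have : (-(2 * Real.pi * Complex.I) * k / n : ℂ) = ((-(2 * Real.pi * k / n) : ℝ) : ℂ) * Complex.I := by
    push_cast; ring
  rw [ncPos, this, Complex.exp_ofReal_mul_I_im, Real.sin_neg]

lemma tri_pos {x y z : ℝ} (h1 : x < y) (h2 : y < z) (h3 : z < x + 2 * Real.pi) :
    0 < Real.sin (y - x) + Real.sin (z - y) - Real.sin (z - x) := by
  have key : ∀ p q : ℝ, Real.sin (2 * p) + Real.sin (2 * q) - Real.sin (2 * (p + q))
      = 4 * Real.sin p * Real.sin q * Real.sin (p + q) := by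
    intro p q
    rw [Real.sin_two_mul, Real.sin_two_mul, Real.sin_two_mul, Real.sin_add, Real.cos_add]
    have hp := Real.sin_sq_add_cos_sq p
    have hq := Real.sin_sq_add_cos_sq q
    linear_combination (-2 * Real.sin p * Real.cos p) * hq + (-2 * Real.sin q * Real.cos q) * hp
  have e := key ((y - x) / 2) ((z - y) / 2)
  have e1 : 2 * ((y - x) / 2) = y - x := by ring
  have e2 : 2 * ((z - y) / 2) = z - y := by ring
  have e3 : 2 * ((y - x) / 2 + (z - y) / 2) = z - x := by ring
  rw [e1, e2, e3] at e
  rw [e]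
  have := Real.sin_pos_of_pos_of_lt_pi (x := (y - x) / 2) (by linarith) (by linarith)
  have := Real.sin_pos_of_pos_of_lt_pi (x := (z - y) / 2) (by linarith) (by linarith)
  have := Real.sin_pos_of_pos_of_lt_pi (x := (y - x) / 2 + (z - y) / 2) (by linarith) (by linarith)
  positivity

lemma chords_meet (A B C D : ℂ) (a b c d : ℝ) (hab : a < b) (hbc : b < c) (hcd : c < d)
    (hda : d < a + 2 * Real.pi)
    (hA1 : A.re = Real.cos a) (hA2 : A.im = -Real.sin a)
    (hB1 : B.re = Real.cos b) (hB2 : B.im = -Real.sin b)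
    (hC1 : C.re = Real.cos c) (hC2 : C.im = -Real.sin c)
    (hD1 : D.re = Real.cos d) (hD2 : D.im = -Real.sin d) :
    ∃ z, z ∈ segment ℝ A C ∧ z ∈ segment ℝ B D := by
  have hx := tri_pos hbc hcd (by linarith)
  have hy := tri_pos (hab.trans hbc) hcd (by linarith)
  have hz := tri_pos hab (hbc.trans hcd) (by linarith)
  have hw := tri_pos hab hbc (by linarith)
  set x := Real.sin (c - b) + Real.sin (d - c) - Real.sin (d - b) with hxd
  set y := Real.sin (c - a) + Real.sin (d - c) - Real.sin (d - a) with hyd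
  set z := Real.sin (b - a) + Real.sin (d - b) - Real.sin (d - a) with hzd
  set w := Real.sin (b - a) + Real.sin (c - b) - Real.sin (c - a) with hwd
  have hsum : x + z = y + w := by rw [hxd, hyd, hzd, hwd]; ring
  have hS : 0 < x + z := by linarith
  have e1 : x * A.re + z * C.re = y * B.re + w * D.re := by
    rw [hA1, hB1, hC1, hD1, hxd, hyd, hzd, hwd]; simp only [Real.sin_sub]; ring
  have e2 : x * A.im + z * C.im = y * B.im + w * D.im := by
    rw [hA2, hB2, hC2, hD2, hxd, hyd, hzd, hwd]; simp only [Real.sin_sub]; ring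
  refine ⟨(x / (x + z)) • A + (z / (x + z)) • C, ?_, ?_⟩
  · exact ⟨_, _, by positivity, by positivity, by field_simp, rfl⟩
  · refine ⟨y / (x + z), w / (x + z), by positivity, by positivity, ?_, ?_⟩
    · rw [← add_div, ← hsum, div_self hS.ne']
    · apply Complex.ext
      · simp only [Complex.add_re, Complex.smul_re, smul_eq_mul]
        field_simp
        linarith
      · simp only [Complex.add_im, Complex.smul_im, smul_eq_mul]
        field_simp
        linarith

lemma ncPos_ne {n a b : ℕ} (hab : a < b) (hb : b < n) : ncPos n a ≠ ncPos n b := by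
  intro h
  have hn : (0 : ℝ) < n := by exact_mod_cast (Nat.zero_le _).trans_lt hb
  have h1 := congrArg Complex.re h
  have h2 := congrArg Complex.im h
  rw [ncPos_re, ncPos_re] at h1
  rw [ncPos_im, ncPos_im] at h2
  set x := 2 * Real.pi * a / n with hx
  set y := 2 * Real.pi * b / n with hy
  have hcos : Real.cos (y - x) = 1 := by
    rw [Real.cos_sub]
    have := Real.sin_sq_add_cos_sq x
    have h3 : Real.sin y = Real.sin x := by linarith
    rw [← h1, h3]; nlinarith
  have hpi := Real.pi_pos
  have hlt : x < y := by
    rw [hx, hy]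
    have : (a : ℝ) < b := by exact_mod_cast hab
    gcongr
  have hy2 : y < 2 * Real.pi := by
    rw [hy, div_lt_iff₀ hn]
    have : (b : ℝ) < n := by exact_mod_cast hb
    gcongr
  have hx0 : 0 ≤ x := by positivity
  have := (Real.cos_eq_one_iff_of_lt_of_lt (x := y - x) (by linarith) (by linarith)).1 hcos
  linarith

lemma no_cross {n : ℕ} (θ : NCTree n) {a b c d : Fin n} (h1 : θ.adj.Adj a c)
    (h2 : θ.adj.Adj b d) (hab : a.val < b.val) (hbc : b.val < c.val) (hcd : c.val < d.val) :
    False := by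
  have hn : (0 : ℝ) < n := by exact_mod_cast (Nat.zero_le _).trans_lt a.2
  have hpi := Real.pi_pos
  have mono : ∀ i j : ℕ, i < j → 2 * Real.pi * i / n < 2 * Real.pi * j / n := by
    intro i j hij
    have : (i : ℝ) < j := by exact_mod_cast hij
    gcongr
  have hlast : 2 * Real.pi * (d.val : ℝ) / n < 2 * Real.pi * (a.val : ℝ) / n + 2 * Real.pi := by
    have h3 : 2 * Real.pi * (d.val : ℝ) / n < 2 * Real.pi := by
      rw [div_lt_iff₀ hn]
      have : (d.val : ℝ) < n := by exact_mod_cast d.2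
      gcongr
    have : 0 ≤ 2 * Real.pi * (a.val : ℝ) / n := by positivity
    linarith
  obtain ⟨z, hz1, hz2⟩ := chords_meet (ncPos n a) (ncPos n b) (ncPos n c) (ncPos n d) _ _ _ _
    (mono _ _ hab) (mono _ _ hbc) (mono _ _ hcd) hlast (ncPos_re _ _) (ncPos_im _ _)
    (ncPos_re _ _) (ncPos_im _ _) (ncPos_re _ _) (ncPos_im _ _) (ncPos_re _ _) (ncPos_im _ _)
  have hne : ({(a : ℕ), (c : ℕ)} : Set ℕ) ≠ {(b : ℕ), (d : ℕ)} := by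
    intro h
    have : (a : ℕ) ∈ ({(b : ℕ), (d : ℕ)} : Set ℕ) := by rw [← h]; simp
    simp at this
    omega
  have := θ.noncrossing a c b d h1 h2 hne ⟨hz1, hz2⟩
  obtain ⟨h3, h4⟩ := this
  rcases h3 with h3 | h3 <;> rcases h4 with h4 | h4 <;> rw [h3] at h4
  · exact ncPos_ne hab b.2 h4
  · exact ncPos_ne (hab.trans (hbc.trans hcd)) d.2 h4
  · exact ncPos_ne hbc c.2 h4.symm
  · exact ncPos_ne hcd d.2 h4

/-! ### Positions -/

lemma exists_change (X Q : List ℕ → Prop) (g : List ℕ)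
    (hX : ∀ v, X v → v ≠ g → v ≠ [] ∧ X v.dropLast) :
    ∀ (k : ℕ) (a : List ℕ), a.length = k → X a → ¬ (Q a ↔ Q g) →
      ∃ v, X v ∧ v ≠ g ∧ ¬ (Q v ↔ Q v.dropLast) := by
  intro k
  induction k with
  | zero =>
    intro a ha hXa hQ
    have hne : a ≠ g := by rintro rfl; exact hQ Iff.rfl
    have : a = [] := List.length_eq_zero_iff.1 ha
    exact absurd this (hX a hXa hne).1
  | succ k ih =>
    intro a ha hXa hQ
    have hne : a ≠ g := by rintro rfl; exact hQ Iff.rfl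
    obtain ⟨h1, h2⟩ := hX a hXa hne
    by_cases h3 : Q a ↔ Q a.dropLast
    · exact ih a.dropLast (by simp [ha]) h2 (by rwa [← h3])
    · exact ⟨a, hXa, hne, h3⟩

section Shape

variable {n : ℕ} {θ : NCTree n} {τ : PlaneTree} {f : List ℕ → Fin n}

lemma pos_inj (hs : IsShape n θ τ f) {u v : List ℕ} (hu : u ∈ τ.verts) (hv : v ∈ τ.verts)
    (h : (f u).val = (f v).val) : u = v :=
  hs.2.1.injOn hu hv (Fin.ext h)

lemma pos_convex (hs : IsShape n θ τ f) {u a c y : List ℕ} (hne : u ≠ [])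
    (ha : a ∈ τ.verts) (hua : u <+: a) (hc : c ∈ τ.verts) (huc : u <+: c)
    (hy : y ∈ τ.verts) (huy : ¬ u <+: y) (h1 : (f a).val < (f y).val)
    (h2 : (f y).val < (f c).val) : False := by
  have hX : ∀ v, (v ∈ τ.verts ∧ u <+: v) → v ≠ u →
      v ≠ [] ∧ (v.dropLast ∈ τ.verts ∧ u <+: v.dropLast) := by
    rintro v ⟨h3, h4⟩ h5
    refine ⟨?_, PlaneTree.dropLast_mem h3, PlaneTree.prefix_dropLast h4 (Ne.symm h5)⟩
    rintro rfl
    simp at h4; exact hne h4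
  obtain ⟨x, x', hx, hx', hxx, hlt1, hlt2⟩ : ∃ x x', (x ∈ τ.verts ∧ u <+: x) ∧
      (x' ∈ τ.verts ∧ u <+: x') ∧ θ.adj.Adj (f x) (f x') ∧ (f x).val < (f y).val ∧
      (f y).val < (f x').val := by
    have : ∃ v, (v ∈ τ.verts ∧ u <+: v) ∧ v ≠ u ∧
        ¬ ((f v).val < (f y).val ↔ (f v.dropLast).val < (f y).val) := by
      by_cases hu : (f u).val < (f y).val
      · exact exists_change (fun v => v ∈ τ.verts ∧ u <+: v) (fun v => (f v).val < (f y).val)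
          u hX _ c rfl ⟨hc, huc⟩ (by simp only [hu, iff_true]; omega)
      · exact exists_change (fun v => v ∈ τ.verts ∧ u <+: v) (fun v => (f v).val < (f y).val)
          u hX _ a rfl ⟨ha, hua⟩ (by simp only [hu, iff_false]; omega)
    obtain ⟨v, hv, hvu, hQ⟩ := this
    obtain ⟨hv0, hv'⟩ := hX v hv hvu
    have hadj := hs.2.2.2.1 v hv.1 hv0
    have n1 : (f v).val ≠ (f y).val := fun h => huy (by rw [← pos_inj hs hv.1 hy h]; exact hv.2)
    have n2 : (f v.dropLast).val ≠ (f y).val :=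
      fun h => huy (by rw [← pos_inj hs hv'.1 hy h]; exact hv'.2)
    by_cases h : (f v).val < (f y).val
    · exact ⟨v, v.dropLast, hv, hv', hadj.symm, h, by
        have : ¬ (f v.dropLast).val < (f y).val := fun h' => hQ ⟨fun _ => h', fun _ => h⟩
        omega⟩
    · exact ⟨v.dropLast, v, hv', hv, hadj, by
        by_contra h'
        exact hQ ⟨fun h'' => absurd h'' h, fun h'' => absurd h'' h'⟩, by omega⟩
  have hY : ∀ v, (v ∈ τ.verts ∧ ¬ u <+: v) → v ≠ [] →
      v ≠ [] ∧ (v.dropLast ∈ τ.verts ∧ ¬ u <+: v.dropLast) := by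
    rintro v ⟨h3, h4⟩ h5
    exact ⟨h5, PlaneTree.dropLast_mem h3, fun h => h4 (h.trans (List.dropLast_prefix v))⟩
  obtain ⟨v, hv, hv0, hQ⟩ := exists_change (fun v => v ∈ τ.verts ∧ ¬ u <+: v)
    (fun v => (f x).val < (f v).val ∧ (f v).val < (f x').val) [] hY _ y rfl ⟨hy, huy⟩
    (by have := hs.2.2.1; simp only [this]; omega)
  obtain ⟨-, hv'⟩ := hY v hv hv0
  have hadj := hs.2.2.2.1 v hv.1 hv0
  have ne : ∀ p q, (p ∈ τ.verts ∧ u <+: p) → (q ∈ τ.verts ∧ ¬ u <+: q) →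
      (f p).val ≠ (f q).val := by
    intro p q hp hq h
    exact hq.2 (by rw [← pos_inj hs hp.1 hq.1 h]; exact hp.2)
  have n1 := ne x v hx hv
  have n2 := ne x' v hx' hv
  have n3 := ne x _ hx hv'
  have n4 := ne x' _ hx' hv'
  have fin : ∀ e e' : Fin n, θ.adj.Adj e e' → (f x).val < e.val → e.val < (f x').val →
      (e'.val < (f x).val ∨ (f x').val < e'.val) → False := by
    intro e e' hee h3 h4 h5
    rcases h5 with h5 | h5
    · exact no_cross θ hee.symm hxx h5 h3 h4
    · exact no_cross θ hxx hee h3 h4 h5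
  by_cases h : (f x).val < (f v).val ∧ (f v).val < (f x').val
  · refine fin _ _ hadj.symm h.1 h.2 ?_
    have : ¬ ((f x).val < (f v.dropLast).val ∧ (f v.dropLast).val < (f x').val) :=
      fun h' => hQ ⟨fun _ => h', fun _ => h⟩
    omega
  · have h' : (f x).val < (f v.dropLast).val ∧ (f v.dropLast).val < (f x').val := by
      by_contra h'
      exact hQ ⟨fun h'' => absurd h'' h, fun h'' => absurd h'' h'⟩
    refine fin _ _ hadj h'.1 h'.2 ?_
    omega

lemma pos_side (hs : IsShape n θ τ f) {u a c y : List ℕ} (hne : u ≠ [])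
    (ha : a ∈ τ.verts) (hua : u <+: a) (hc : c ∈ τ.verts) (huc : u <+: c)
    (hy : y ∈ τ.verts) (huy : ¬ u <+: y) (h1 : (f a).val < (f y).val) :
    (f c).val < (f y).val := by
  by_contra h
  have : (f c).val ≠ (f y).val := fun h' => huy (by rw [← pos_inj hs hc hy h']; exact huc)
  exact pos_convex hs hne ha hua hc huc hy huy h1 (by omega)

lemma pos_side' (hs : IsShape n θ τ f) {u a c y : List ℕ} (hne : u ≠ [])
    (ha : a ∈ τ.verts) (hua : u <+: a) (hc : c ∈ τ.verts) (huc : u <+: c)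
    (hy : y ∈ τ.verts) (huy : ¬ u <+: y) (h1 : (f y).val < (f a).val) :
    (f y).val < (f c).val := by
  by_contra h
  have : (f c).val ≠ (f y).val := fun h' => huy (by rw [← pos_inj hs hc hy h']; exact huc)
  exact pos_convex hs hne hc huc ha hua hy huy (by omega) h1

lemma fin_sub_val (a b : Fin n) : (a - b).val = if b.val ≤ a.val then a.val - b.val
    else n + a.val - b.val := by
  have ha := a.2
  have hb := b.2
  rw [Fin.sub_def]
  simp only
  split_ifs with h
  · rw [show n - b.val + a.val = (a.val - b.val) + n by omega, Nat.add_mod_right,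
      Nat.mod_eq_of_lt (by omega)]
  · rw [show n - b.val + a.val = n + a.val - b.val by omega, Nat.mod_eq_of_lt (by omega)]

lemma pos_sib (hs : IsShape n θ τ f) {u : List ℕ} {i j : ℕ} (hi : u ++ [i] ∈ τ.verts)
    (hj : u ++ [j] ∈ τ.verts) (hij : i < j) : (f (u ++ [i])).val < (f (u ++ [j])).val := by
  have hu : u ∈ τ.verts := τ.prefix_closed _ _ ⟨_, rfl⟩ hi
  have h1 : 1 ≤ i := τ.labels_pos _ hi i (by simp)
  have h := hs.2.2.2.2.2 u hu i j h1 hij hj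
  rw [Fin.lt_def, fin_sub_val, fin_sub_val] at h
  rcases eq_or_ne u [] with rfl | hne
  · have h0 := hs.2.2.1
    simp only [List.dropLast_nil, h0] at h
    simpa using h
  have hp : ¬ u <+: u.dropLast := fun h' =>
    absurd ((PlaneTree.dropLast_lt hne).trans_le (word_prefix_le h')) (lt_irrefl _)
  have hd := PlaneTree.dropLast_mem hu
  have s1 := pos_side hs hne hi ⟨_, rfl⟩ hj ⟨_, rfl⟩ hd hp
  have s2 := pos_side hs hne hj ⟨_, rfl⟩ hi ⟨_, rfl⟩ hd hp
  have l1 := (f (u ++ [i])).2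
  have l2 := (f (u ++ [j])).2
  split_ifs at h <;> omega

lemma not_prefix_sib {u : List ℕ} {i j : ℕ} (hij : i ≠ j) (x : List ℕ) :
    ¬ u ++ [i] <+: u ++ j :: x := by
  rintro ⟨t, ht⟩
  simp at ht
  exact hij ht.1

lemma pos_lt (hs : IsShape n θ τ f) {u v : List ℕ} (hu : u ∈ τ.verts) (hv : v ∈ τ.verts)
    (h : u < v) (hn : ¬ u <+: v) : (f u).val < (f v).val := by
  rcases word_lt_decomp u v h with h | ⟨w, i, j, u', v', hij, rfl, rfl⟩
  · exact absurd h hn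
  have pi : w ++ [i] <+: w ++ i :: u' := ⟨u', by simp⟩
  have pj : w ++ [j] <+: w ++ j :: v' := ⟨v', by simp⟩
  have hi := τ.prefix_closed _ _ pi hu
  have hj := τ.prefix_closed _ _ pj hv
  have h1 := pos_sib hs hi hj hij
  have h2 := pos_side hs (by simp) hi (List.prefix_refl _) hu pi hj (not_prefix_sib hij.ne []) h1
  exact pos_side' hs (by simp) hj (List.prefix_refl _) hv pj hu (not_prefix_sib hij.ne' u') h2

lemma pos_card (hs : IsShape n θ τ f) (x : List ℕ) :
    (τ.verts.filter (fun v => (f v).val < (f x).val)).card = (f x).val := by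
  refine Eq.trans ?_ (Fin.card_Iio (f x))
  apply Finset.card_bij (fun v _ => f v)
  · intro v hv
    rw [Finset.mem_filter] at hv
    rw [Finset.mem_Iio, Fin.lt_def]; exact hv.2
  · intro a ha b hb h
    rw [Finset.mem_filter] at ha hb
    exact pos_inj hs ha.1 hb.1 (congrArg Fin.val h)
  · intro p hp
    obtain ⟨v, hv, rfl⟩ := hs.2.1.surjOn (Set.mem_univ p)
    rw [Finset.mem_Iio, Fin.lt_def] at hp
    exact ⟨v, by rw [Finset.mem_filter]; exact ⟨hv, hp⟩, rfl⟩

lemma pos_ge_of (hs : IsShape n θ τ f) {x : List ℕ} (hx : x ∈ τ.verts) (A : Finset (List ℕ))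
    (hA : ∀ v ∈ A, v ∈ τ.verts) (h : ∀ v ∈ A, ¬ v <+: x → (f v).val < (f x).val) :
    A.card ≤ (f x).val + (τ.height + 1) := by
  have hsub : A ⊆ τ.verts.filter (fun v => (f v).val < (f x).val) ∪ x.inits.toFinset := by
    intro v hv
    rw [Finset.mem_union, Finset.mem_filter, List.mem_toFinset, List.mem_inits]
    by_cases hp : v <+: x
    · exact Or.inr hp
    · exact Or.inl ⟨hA v hv, h v hv hp⟩
  have h1 := Finset.card_le_card hsub
  have h2 := Finset.card_union_le (τ.verts.filter (fun v => (f v).val < (f x).val))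
    x.inits.toFinset
  have h3 := List.toFinset_card_le x.inits
  rw [List.length_inits] at h3
  rw [pos_card hs] at h2
  have := PlaneTree.length_le_height hx
  omega

lemma pos_le_of (hs : IsShape n θ τ f) {x : List ℕ} (A : Finset (List ℕ))
    (h : ∀ v ∈ τ.verts, (f v).val < (f x).val → v ∈ A) : (f x).val ≤ A.card := by
  rw [← pos_card hs x]
  apply Finset.card_le_card
  intro v hv
  rw [Finset.mem_filter] at hv
  exact h v hv.1 hv.2

lemma idx_le_pos (hs : IsShape n θ τ f) {x : List ℕ} (hx : x ∈ τ.verts) :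
    τ.idx x ≤ (f x).val + (τ.height + 1) := by
  refine pos_ge_of hs hx _ (fun v hv => (PlaneTree.mem_low.1 hv).1) ?_
  intro v hv hp
  rw [PlaneTree.mem_low] at hv
  exact pos_lt hs hv.1 hx hv.2 hp

lemma pos_lt_fin (hs : IsShape n θ τ f) {x : List ℕ} (hx : x ∈ τ.verts) :
    (f x).val < τ.fin x := by
  have hm : x ∈ τ.upp x := PlaneTree.mem_upp.2 ⟨hx, Or.inr (List.prefix_refl x)⟩
  have h1 : (f x).val ≤ ((τ.upp x).erase x).card := by
    refine pos_le_of hs _ ?_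
    intro v hv hlt
    rw [Finset.mem_erase, PlaneTree.mem_upp]
    refine ⟨by rintro rfl; omega, hv, ?_⟩
    by_contra hc
    push Not at hc
    have h2 : x < v := lt_of_le_of_ne hc.1 (by rintro rfl; omega)
    have := pos_lt hs hx hv h2 hc.2
    omega
  rw [Finset.card_erase_of_mem hm] at h1
  have := Finset.card_pos.2 ⟨x, hm⟩
  unfold PlaneTree.fin
  omega

lemma pos_le_idx_right (hs : IsShape n θ τ f) {w : List ℕ} {i : ℕ} (hx : w ++ [i] ∈ τ.verts)
    (h : (f w).val < (f (w ++ [i])).val) : (f w).val ≤ τ.idx (w ++ [i]) := by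
  have hw : w ∈ τ.verts := τ.prefix_closed _ _ ⟨_, rfl⟩ hx
  refine pos_le_of hs _ ?_
  intro v hv hlt
  rw [PlaneTree.mem_low]
  refine ⟨hv, ?_⟩
  by_contra hc
  have h2 : w ++ [i] < v := lt_of_le_of_ne (not_lt.1 hc) (by rintro rfl; omega)
  by_cases hp : w ++ [i] <+: v
  · have := pos_side' hs (by simp) hx (List.prefix_refl _) hv hp hw (fun h' =>
      absurd ((word_lt_concat w i).trans_le (word_prefix_le h')) (lt_irrefl _)) h
    omega
  · have := pos_lt hs hx hv h2 hp
    omega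

lemma fin_le_pos_left (hs : IsShape n θ τ f) {w : List ℕ} {i : ℕ} (hx : w ++ [i] ∈ τ.verts)
    (h : (f (w ++ [i])).val < (f w).val) :
    τ.fin (w ++ [i]) ≤ (f w).val + (τ.height + 1) := by
  have hw : w ∈ τ.verts := τ.prefix_closed _ _ ⟨_, rfl⟩ hx
  refine pos_ge_of hs hw _ (fun v hv => (PlaneTree.mem_upp.1 hv).1) ?_
  intro v hv hp
  rw [PlaneTree.mem_upp] at hv
  by_cases hp2 : w ++ [i] <+: v
  · exact pos_side hs (by simp) hx (List.prefix_refl _) hv.1 hp2 hw (fun h' =>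
      absurd ((word_lt_concat w i).trans_le (word_prefix_le h')) (lt_irrefl _)) h
  · have h3 : v < w ++ [i] := by tauto
    have : ¬ v <+: w ++ [i] := by
      intro h'
      rcases List.prefix_concat_iff.1 h' with rfl | h'
      · exact lt_irrefl _ h3
      · exact hp h'
    have := pos_lt hs hv.1 hx h3 this
    omega

/-- The key fact: the position of `w` is close to a time where the path is low. -/
lemma pos_mid (hs : IsShape n θ τ f) {w : List ℕ} (hw : w ∈ τ.verts) :
    ∃ b, b ≤ n ∧ (f w).val ≤ b ∧ b ≤ (f w).val + (τ.height + 1) ∧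
      τ.lukas b ≤ τ.lukas (τ.idx w + 1) := by
  by_cases hr : ∃ i, w ++ [i] ∈ τ.verts ∧ (f w).val < (f (w ++ [i])).val
  · classical
    let i := Nat.find hr
    obtain ⟨hi1, hi2⟩ := Nat.find_spec hr
    have hmin : ∀ k < i, w ++ [k] ∈ τ.verts → ¬ (f w).val < (f (w ++ [k])).val :=
      fun k hk h1 h2 => Nat.find_min hr hk ⟨h1, h2⟩
    refine ⟨τ.idx (w ++ [i]), ?_, pos_le_idx_right hs hi1 hi2, ?_, PlaneTree.lukas_child_le hi1⟩
    · rw [← hs.1]; exact Finset.card_le_card (Finset.filter_subset _ _)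
    · refine pos_ge_of hs hw _ (fun v hv => (PlaneTree.mem_low.1 hv).1) ?_
      intro v hv hp
      rw [PlaneTree.mem_low] at hv
      by_cases hp2 : w <+: v
      · obtain ⟨t, rfl⟩ := hp2
        rcases t with _ | ⟨k, t⟩
        · simp at hp
        have pk : w ++ [k] <+: w ++ k :: t := ⟨t, by simp⟩
        have hk := τ.prefix_closed _ _ pk hv.1
        have hki : k < i := by
          by_contra hc
          rcases (not_lt.1 hc).lt_or_eq with h | h
          · exact absurd ((word_lt_of_decomp w [] t h).trans hv.2) (lt_irrefl _)
          · rw [← h] at pk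
            exact absurd ((word_prefix_le pk).trans_lt (by rw [h] at hv ⊢; exact hv.2)) (by
              rw [h]; exact lt_irrefl _)
        have h4 := hmin k hki hk
        have h5 : (f (w ++ [k])).val ≠ (f w).val := fun h' => by
          have := pos_inj hs hk hw h'
          simp at this
        exact pos_side hs (by simp) hk (List.prefix_refl _) hv.1 pk hw (fun h' =>
          absurd ((word_lt_concat w k).trans_le (word_prefix_le h')) (lt_irrefl _)) (by omega)
      · apply pos_lt hs hv.1 hw _ hp
        by_contra hc
        have h3 : w < v := lt_of_le_of_ne (not_lt.1 hc) (by rintro rfl; simp at hp)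
        exact absurd ((word_after (⟨_, rfl⟩ : w <+: w ++ [i]) h3 hp2).trans hv.2) (lt_irrefl _)
  · push Not at hr
    refine ⟨τ.fin w, ?_, (pos_lt_fin hs hw).le, ?_, ?_⟩
    · rw [← hs.1]; exact PlaneTree.fin_le_card w
    · refine pos_ge_of hs hw _ (fun v hv => (PlaneTree.mem_upp.1 hv).1) ?_
      intro v hv hp
      rw [PlaneTree.mem_upp] at hv
      by_cases hp2 : w <+: v
      · obtain ⟨t, rfl⟩ := hp2
        rcases t with _ | ⟨k, t⟩
        · simp at hp
        have pk : w ++ [k] <+: w ++ k :: t := ⟨t, by simp⟩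
        have hk := τ.prefix_closed _ _ pk hv.1
        have h4 := hr k hk
        have h5 : (f (w ++ [k])).val ≠ (f w).val := fun h' => by
          have := pos_inj hs hk hw h'
          simp at this
        exact pos_side hs (by simp) hk (List.prefix_refl _) hv.1 pk hw (fun h' =>
          absurd ((word_lt_concat w k).trans_le (word_prefix_le h')) (lt_irrefl _)) (by omega)
      · exact pos_lt hs hv.1 hw (by tauto) hp
    · rw [PlaneTree.lukas_fin_eq hw, PlaneTree.lukas_succ hw]; omega

def GoodPos (τ : PlaneTree) (n a e x : ℕ) : Prop :=
  a ≤ x + (τ.height + 1) ∧ x < e ∧ ∃ c < n, ∃ b ≤ n, τ.lukas c ≤ τ.lukas (a + 1) ∧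
    τ.lukas b ≤ τ.lukas (c + 1) ∧ x ≤ b ∧ b ≤ x + (τ.height + 1)

lemma combi_edge (hs : IsShape n θ τ f) {x y : Fin n} (hxy : θ.adj.Adj x y) :
    ∃ a e, a < e ∧ e ≤ n ∧ (∀ j, a ≤ j → j < e → τ.lukas a ≤ τ.lukas j) ∧
      GoodPos τ n a e x ∧ GoodPos τ n a e y := by
  have main : ∀ u ∈ τ.verts, ∀ v ∈ τ.verts, θ.adj.Adj (f u) (f v) → u = v.dropLast →
      ∃ a e, a < e ∧ e ≤ n ∧ (∀ j, a ≤ j → j < e → τ.lukas a ≤ τ.lukas j) ∧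
      GoodPos τ n a e (f u) ∧ GoodPos τ n a e (f v) := by
    intro u hu v hv hadj huv
    have hne : v ≠ [] := by rintro rfl; simp at huv; subst huv; exact θ.adj.irrefl hadj
    have hv2 : v = u ++ [v.getLast hne] := by rw [huv, List.dropLast_append_getLast]
    generalize v.getLast hne = i at hv2
    subst hv2
    have hp : u <+: u ++ [i] := ⟨_, rfl⟩
    have hle := PlaneTree.lukas_child_le hv
    have hcard : ∀ z ∈ τ.verts, τ.idx z < n := by
      intro z hz
      rw [← hs.1]
      exact (PlaneTree.idx_lt_fin hz).trans_le (PlaneTree.fin_le_card z)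
    refine ⟨τ.idx u, τ.fin u, PlaneTree.idx_lt_fin hu, ?_, fun j => PlaneTree.lukas_ge, ?_, ?_⟩
    · rw [← hs.1]; exact PlaneTree.fin_le_card u
    · obtain ⟨b, h1, h2, h3, h4⟩ := pos_mid hs hu
      exact ⟨idx_le_pos hs hu, pos_lt_fin hs hu, τ.idx u, hcard u hu, b, h1,
        (PlaneTree.lukas_des_ge hv hp).trans hle, h4, h2, h3⟩
    · obtain ⟨b, h1, h2, h3, h4⟩ := pos_mid hs hv
      exact ⟨(PlaneTree.idx_mono (word_prefix_le hp)).trans (idx_le_pos hs hv),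
        (pos_lt_fin hs hv).trans_le (PlaneTree.fin_mono hp), _, hcard _ hv, b, h1,
        hle, h4, h2, h3⟩
  obtain ⟨u, hu, rfl⟩ := hs.2.1.surjOn (Set.mem_univ x)
  obtain ⟨v, hv, rfl⟩ := hs.2.1.surjOn (Set.mem_univ y)
  rcases hs.2.2.2.2.1 u hu v hv hxy with h | h
  · exact main u hu v hv hxy h
  · obtain ⟨a, e, h1, h2, h3, h4, h5⟩ := main v hv u hu hxy.symm h
    exact ⟨a, e, h1, h2, h3, h5, h4⟩

lemma adj_child (hs : IsShape n θ τ f) {u : List ℕ} {i : ℕ} (h : u ++ [i] ∈ τ.verts) :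
    θ.adj.Adj (f u) (f (u ++ [i])) := by
  have := hs.2.2.2.1 _ h (by simp)
  rwa [List.dropLast_concat] at this

lemma combi_branch (hs : IsShape n θ τ f) {v : List ℕ} (hv : v ∈ τ.verts) {j₀ j₁ : ℕ}
    (hj : j₀ < j₁) (hj1 : j₁ ≤ v.length)
    (hW : τ.lukas (τ.idx (v.take j₀)) < τ.lukas (τ.idx (v.take j₁)))
    (hI : τ.idx (v.take j₀) + τ.height < τ.idx (v.take j₁)) :
    ∃ x y : Fin n, θ.adj.Adj x y ∧
      τ.idx (v.take j₀) ≤ x.val + (τ.height + 1) ∧ x.val ≤ τ.idx (v.take j₁) ∧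
      τ.fin (v.take j₁) ≤ y.val + (τ.height + 1) ∧ y.val ≤ τ.fin (v.take j₀) := by
  have hw : ∀ j, v.take j ∈ τ.verts := fun j => τ.prefix_closed _ _ (List.take_prefix j v) hv
  have hpre : ∀ i j, i ≤ j → v.take i <+: v.take j := fun i j hij =>
    List.take_prefix_take_left hij
  have hidx : ∀ i j, i ≤ j → τ.idx (v.take i) ≤ τ.idx (v.take j) := fun i j hij =>
    PlaneTree.idx_mono (word_prefix_le (hpre i j hij))
  have hfin : ∀ i j, i ≤ j → τ.fin (v.take j) ≤ τ.fin (v.take i) := fun i j hij =>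
    PlaneTree.fin_mono (hpre i j hij)
  have hstep : ∀ j (h : j < j₁), v.take (j + 1) = v.take j ++ [v[j]] := fun j h => by
    rw [List.take_append_getElem]
  have hL : ∀ j, j₀ ≤ j → j < j₁ → (f (v.take j)).val < (f (v.take (j + 1))).val →
      τ.idx (v.take j₀) ≤ (f (v.take j)).val + (τ.height + 1) ∧
        (f (v.take j)).val ≤ τ.idx (v.take j₁) := by
    intro j h1 h2 h3
    refine ⟨(hidx _ _ h1).trans (idx_le_pos hs (hw j)), ?_⟩
    have h4 := hidx (j + 1) j₁ h2
    have hm := hw (j + 1)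
    rw [hstep j h2] at h3 h4 hm
    exact (pos_le_idx_right hs hm h3).trans h4
  have hR : ∀ j, j₀ ≤ j → j < j₁ → ¬ (f (v.take j)).val < (f (v.take (j + 1))).val →
      τ.fin (v.take j₁) ≤ (f (v.take j)).val + (τ.height + 1) ∧
        (f (v.take j)).val ≤ τ.fin (v.take j₀) := by
    intro j h1 h2 h3
    refine ⟨?_, (pos_lt_fin hs (hw j)).le.trans (hfin _ _ h1)⟩
    have h4 := hfin (j + 1) j₁ h2
    have hm := hw (j + 1)
    rw [hstep j h2] at h3 h4 hm
    have h5 : (f (v.take j ++ [v[j]])).val ≠ (f (v.take j)).val := fun h' => by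
      have := pos_inj hs hm (hw j) h'
      simp at this
      omega
    exact h4.trans (fin_le_pos_left hs hm (by omega))
  have hadj : ∀ j, j < j₁ → θ.adj.Adj (f (v.take j)) (f (v.take (j + 1))) := by
    intro j h
    have hm := hw (j + 1)
    rw [hstep j h] at hm ⊢
    exact adj_child hs hm
  by_cases hch : ∃ j, j₀ ≤ j ∧ j + 1 < j₁ ∧
      ¬ ((f (v.take j)).val < (f (v.take (j + 1))).val ↔
        (f (v.take (j + 1))).val < (f (v.take (j + 1 + 1))).val)
  · obtain ⟨j, h1, h2, h3⟩ := hch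
    by_cases hT : (f (v.take j)).val < (f (v.take (j + 1))).val
    · have hT2 : ¬ (f (v.take (j + 1))).val < (f (v.take (j + 1 + 1))).val :=
        fun h => h3 ⟨fun _ => h, fun _ => hT⟩
      have a := hL j h1 (by omega) hT
      have b := hR (j + 1) (by omega) h2 hT2
      exact ⟨_, _, hadj j (by omega), a.1, a.2, b.1, b.2⟩
    · have hT2 : (f (v.take (j + 1))).val < (f (v.take (j + 1 + 1))).val := by
        by_contra h
        exact h3 ⟨fun h' => absurd h' hT, fun h' => absurd h' h⟩
      have a := hL (j + 1) (by omega) h2 hT2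
      have b := hR j h1 (by omega) hT
      exact ⟨_, _, (hadj j (by omega)).symm, a.1, a.2, b.1, b.2⟩
  have hall : ∀ j, j₀ ≤ j → j < j₁ → ((f (v.take j)).val < (f (v.take (j + 1))).val ↔
      (f (v.take j₀)).val < (f (v.take (j₀ + 1))).val) := by
    intro j h1
    induction j, h1 using Nat.le_induction with
    | base => intro _; exact Iff.rfl
    | succ k hk ih =>
      intro h2
      rw [← ih (by omega)]
      by_contra h3
      exact hch ⟨k, hk, h2, fun h => h3 h.symm⟩
  by_cases hT : (f (v.take j₀)).val < (f (v.take (j₀ + 1))).val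
  · -- right child
    obtain ⟨j, h1, h2, h3⟩ : ∃ j, j₀ ≤ j ∧ j < j₁ ∧
        τ.lukas (τ.idx (v.take j)) < τ.lukas (τ.idx (v.take (j + 1))) := by
      by_contra hc
      push Not at hc
      have : ∀ j, j₀ ≤ j → j ≤ j₁ → τ.lukas (τ.idx (v.take j)) ≤ τ.lukas (τ.idx (v.take j₀)) := by
        intro j h1
        induction j, h1 using Nat.le_induction with
        | base => intro _; exact le_rfl
        | succ k hk ih => intro h2; exact (hc k hk h2).trans (ih (by omega))
      have := this j₁ hj.le le_rfl
      omega
    have a := hL j h1 h2 ((hall j h1 h2).2 hT)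
    have hm := hw (j + 1)
    have hf2 := hfin (j + 1) j₁ h2
    rw [hstep j h2] at hm h3 hf2
    obtain ⟨i, hi, hd⟩ := PlaneTree.right_sibling hm h3
    refine ⟨_, _, adj_child hs hd, a.1, a.2, ?_, ?_⟩
    · refine hf2.trans ((PlaneTree.fin_le_idx (word_lt_of_decomp _ [] [] hi) ?_).trans
        (idx_le_pos hs hd))
      exact not_prefix_sib hi.ne []
    · exact (pos_lt_fin hs hd).le.trans ((PlaneTree.fin_mono ⟨_, rfl⟩).trans (hfin _ _ h1))
  · obtain ⟨j, h1, h2, h3⟩ : ∃ j, j₀ ≤ j ∧ ∃ h : j < j₁, v[j] ≠ 1 := by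
      by_contra hc
      push Not at hc
      have : ∀ j, j₀ ≤ j → j ≤ j₁ → τ.idx (v.take j) = τ.idx (v.take j₀) + (j - j₀) := by
        intro j h1
        induction j, h1 using Nat.le_induction with
        | base => intro _; simp
        | succ k hk ih =>
          intro h2
          have e : τ.idx (v.take (k + 1)) = τ.idx (v.take k) + 1 := by
            rw [hstep k h2, hc k hk h2]
            refine PlaneTree.idx_succ (hw k) (word_lt_concat _ _) ?_
            intro y hy hlt
            rcases word_lt_decomp _ _ hlt with hp | ⟨w, i, i', u', v', hii, e1, e2⟩
            · obtain ⟨t, rfl⟩ := hp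
              rcases t with _ | ⟨b, t⟩
              · simp at hlt
              have hb : 1 ≤ b := τ.labels_pos _ hy b (by simp)
              rcases hb.lt_or_eq with hb | hb
              · exact (word_lt_of_decomp _ _ _ hb).le
              · rw [← hb]
                exact word_prefix_le ⟨t, by simp⟩
            · rw [e1, e2, List.append_assoc]
              exact (word_lt_of_decomp w _ _ hii).le
          rw [e, ih (by omega)]; omega
      have h4 := this j₁ hj.le le_rfl
      have := PlaneTree.length_le_height hv
      omega
    have b := hR j h1 h2 (fun h => hT ((hall j h1 h2).1 h))
    have hm := hw (j + 1)
    have hf2 := hidx (j + 1) j₁ h2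
    rw [hstep j h2] at hm hf2
    have hpos : 1 ≤ v[j] := τ.labels_pos _ hv _ (List.getElem_mem _)
    have hlt : 1 < v[j] := by omega
    have hd := PlaneTree.child_of_le le_rfl hpos hm
    refine ⟨_, _, (adj_child hs hd).symm, ?_, ?_, b.1, b.2⟩
    · exact ((hidx _ _ h1).trans (PlaneTree.idx_mono (word_prefix_le ⟨_, rfl⟩))).trans
        (idx_le_pos hs hd)
    · refine (pos_lt_fin hs hd).le.trans ((PlaneTree.fin_le_idx (x := v.take j ++ [v[j]])
        (word_lt_of_decomp _ [] [] hlt) ?_).trans hf2)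
      exact not_prefix_sib hlt.ne []

end Shape

/-! ### Chords -/

lemma ncPos_eq_cpt (n k : ℕ) : ncPos n k = cpt ((k : ℝ) / n) := by
  unfold ncPos cpt
  push_cast
  congr 1
  ring

lemma cpt_eq (s : ℝ) : cpt s = Complex.exp (Complex.I * ((-(2 * Real.pi * s) : ℝ) : ℂ)) := by
  unfold cpt
  push_cast
  congr 1
  ring

lemma norm_cpt (s : ℝ) : ‖cpt s‖ = 1 := by
  rw [cpt_eq, mul_comm, Complex.norm_exp_ofReal_mul_I]

lemma cpt_dist (s t : ℝ) : dist (cpt s) (cpt t) ≤ 7 * |s - t| := by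
  have h : cpt s - cpt t = cpt t *
      (Complex.exp (Complex.I * ((-(2 * Real.pi * (s - t)) : ℝ) : ℂ)) - 1) := by
    rw [mul_sub, mul_one, cpt_eq, cpt_eq, ← Complex.exp_add]
    congr 2
    push_cast
    ring
  rw [dist_eq_norm, h, norm_mul, norm_cpt, one_mul]
  refine (Real.norm_exp_I_mul_ofReal_sub_one_le).trans ?_
  rw [Real.norm_eq_abs, abs_neg, abs_mul, abs_of_pos (by positivity)]
  have := Real.pi_lt_d2
  have := abs_nonneg (s - t)
  nlinarith

lemma chord_near {p q p' q' δ : ℝ} (hp : |p - p'| ≤ δ) (hq : |q - q'| ≤ δ) {x : ℂ}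
    (hx : x ∈ chord p q) : ∃ y ∈ chord p' q', dist x y ≤ 7 * δ := by
  obtain ⟨a, b, ha, hb, hab, rfl⟩ := hx
  refine ⟨a • cpt p' + b • cpt q', ⟨a, b, ha, hb, hab, rfl⟩, ?_⟩
  have h1 := cpt_dist p p'
  have h2 := cpt_dist q q'
  rw [dist_eq_norm] at *
  have : a • cpt p + b • cpt q - (a • cpt p' + b • cpt q')
      = a • (cpt p - cpt p') + b • (cpt q - cpt q') := by
    simp only [smul_sub]; ring
  rw [this]
  refine (norm_add_le _ _).trans ?_
  rw [norm_smul, norm_smul, Real.norm_of_nonneg ha, Real.norm_of_nonneg hb]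
  have e1 : a * ‖cpt p - cpt p'‖ ≤ a * (7 * δ) := by
    apply mul_le_mul_of_nonneg_left _ ha; linarith
  have e2 : b * ‖cpt q - cpt q'‖ ≤ b * (7 * δ) := by
    apply mul_le_mul_of_nonneg_left _ hb; linarith
  have : a * (7 * δ) + b * (7 * δ) = 7 * δ := by rw [← add_mul, hab, one_mul]
  linarith

lemma chord_symm (p q : ℝ) : chord p q = chord q p := segment_symm ℝ _ _

lemma mem_ncSet {n : ℕ} {θ : NCTree n} {x y : Fin n} (h : θ.adj.Adj x y) {z : ℂ}
    (hz : z ∈ chord ((x.val : ℝ) / n) ((y.val : ℝ) / n)) : z ∈ ncSet n θ := by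
  unfold ncSet
  simp only [Set.mem_iUnion]
  refine ⟨x, y, h, ?_⟩
  rw [ncPos_eq_cpt, ncPos_eq_cpt]
  exact hz

/-! ### The relation -/

lemma relF_of {f : ℝ → ℝ} {p q : ℝ} (h1 : f p = f q)
    (h2 : ∀ z ∈ Set.Icc (min p q) (max p q), f p ≤ f z) : relF f p q := by
  have hL : IsLeast (f '' Set.Icc (min p q) (max p q)) (f p) :=
    ⟨⟨p, ⟨min_le_left _ _, le_max_left _ _⟩, rfl⟩, by rintro _ ⟨z, hz, rfl⟩; exact h2 z hz⟩
  exact ⟨h1, hL.csInf_eq.symm⟩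

lemma relF_le {f : ℝ → ℝ} (hnn : ∀ s ∈ Set.Icc (0 : ℝ) 1, 0 ≤ f s) {p q : ℝ}
    (hp : p ∈ Set.Icc (0 : ℝ) 1) (hq : q ∈ Set.Icc (0 : ℝ) 1)
    (h : relF f p q) {z : ℝ} (hz : z ∈ Set.Icc (min p q) (max p q)) : f p ≤ f z := by
  rw [h.2]
  refine csInf_le ⟨0, ?_⟩ ⟨z, hz, rfl⟩
  rintro _ ⟨y, hy, rfl⟩
  exact hnn y ⟨(le_min hp.1 hq.1).trans hy.1, hy.2.trans (max_le hp.2 hq.2)⟩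

lemma relF_compact {f : ℝ → ℝ} (hcont : ContinuousOn f (Set.Icc 0 1)) {ε : ℝ} (hε : 0 < ε) :
    ∃ δ > 0, ∀ p ∈ Set.Icc (0 : ℝ) 1, ∀ q ∈ Set.Icc (0 : ℝ) 1, |f p - f q| ≤ δ →
      (∀ z ∈ Set.Icc (min p q) (max p q), f p - δ ≤ f z) →
      ∃ p' ∈ Set.Icc (0 : ℝ) 1, ∃ q' ∈ Set.Icc (0 : ℝ) 1, relF f p' q' ∧
        |p - p'| ≤ ε ∧ |q - q'| ≤ ε := by
  by_contra hcon
  push Not at hcon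
  have hδ : ∀ k : ℕ, (0 : ℝ) < 1 / ((k : ℝ) + 1) := fun k => by positivity
  choose p hp q hq h1 h2 h3 using fun k : ℕ => hcon (1 / ((k : ℝ) + 1)) (hδ k)
  obtain ⟨⟨a, b⟩, hab, φ, hφ, hlim⟩ :=
    (isCompact_Icc.prod isCompact_Icc : IsCompact (Set.Icc (0 : ℝ) 1 ×ˢ Set.Icc (0 : ℝ) 1)).tendsto_subseq
      (x := fun k => (p k, q k)) (fun k => ⟨hp k, hq k⟩)
  have ha : Tendsto (fun k => p (φ k)) atTop (nhds a) :=
    (continuous_fst.tendsto (a, b)).comp hlim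
  have hb : Tendsto (fun k => q (φ k)) atTop (nhds b) :=
    (continuous_snd.tendsto (a, b)).comp hlim
  have hd : Tendsto (fun k => 1 / ((φ k : ℝ) + 1)) atTop (nhds 0) :=
    (tendsto_one_div_add_atTop_nhds_zero_nat (𝕜 := ℝ)).comp hφ.tendsto_atTop
  have fl : ∀ (x : ℕ → ℝ) (c : ℝ), c ∈ Set.Icc (0 : ℝ) 1 → (∀ k, x k ∈ Set.Icc (0 : ℝ) 1) →
      Tendsto x atTop (nhds c) → Tendsto (fun k => f (x k)) atTop (nhds (f c)) := by
    intro x c hc hx hxc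
    exact (hcont c hc).tendsto.comp
      (tendsto_nhdsWithin_iff.2 ⟨hxc, Eventually.of_forall hx⟩)
  have fa := fl _ a hab.1 (fun k => hp (φ k)) ha
  have fb := fl _ b hab.2 (fun k => hq (φ k)) hb
  have hrel : relF f a b := by
    apply relF_of
    · have : |f a - f b| ≤ 0 :=
        le_of_tendsto_of_tendsto (fa.sub fb).abs hd (Eventually.of_forall fun k => h1 (φ k))
      have := abs_eq_zero.1 (le_antisymm this (abs_nonneg _))
      linarith
    · intro z hz
      have hz1 : z ∈ Set.Icc (0 : ℝ) 1 :=
        ⟨(le_min hab.1.1 hab.2.1).trans hz.1, hz.2.trans (max_le hab.1.2 hab.2.2)⟩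
      let x : ℕ → ℝ := fun k => max (min (p (φ k)) (q (φ k))) (min z (max (p (φ k)) (q (φ k))))
      have hxm : ∀ k, x k ∈ Set.Icc (min (p (φ k)) (q (φ k))) (max (p (φ k)) (q (φ k))) :=
        fun k => ⟨le_max_left _ _, max_le (min_le_max) (min_le_right _ _)⟩
      have hx : Tendsto x atTop (nhds z) := by
        have : Tendsto x atTop (nhds (max (min a b) (min z (max a b)))) :=
          (ha.min hb).max (tendsto_const_nhds.min (ha.max hb))
        rwa [min_eq_left hz.2, max_eq_right hz.1] at this
      have fx := fl x z hz1 (fun k => ⟨(le_min (hp _).1 (hq _).1).trans (hxm k).1,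
        (hxm k).2.trans (max_le (hp _).2 (hq _).2)⟩) hx
      have := le_of_tendsto_of_tendsto (fa.sub hd) fx
        (Eventually.of_forall fun k => h2 (φ k) (x k) (hxm k))
      simpa using this
  have e1 := (Metric.tendsto_nhds.1 ha) ε hε
  have e2 := (Metric.tendsto_nhds.1 hb) ε hε
  obtain ⟨k, hk1, hk2⟩ := (e1.and e2).exists
  rw [Real.dist_eq] at hk1 hk2
  have := h3 (φ k) a hab.1 b hab.2 hrel hk1.le
  linarith

/-! ### Convergence consequences -/

section Conv

variable {f : ℝ → ℝ} {θ : ∀ n : ℕ, NCTree (n + 1)} {τ : ℕ → PlaneTree}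
  {emb : ∀ n : ℕ, List ℕ → Fin (n + 1)} {B : ℕ → ℝ}

lemma unif_cont (hcont : ContinuousOn f (Set.Icc 0 1)) {ε : ℝ} (hε : 0 < ε) :
    ∃ δ > 0, ∀ s ∈ Set.Icc (0 : ℝ) 1, ∀ t ∈ Set.Icc (0 : ℝ) 1, |s - t| < δ → |f s - f t| < ε := by
  have := isCompact_Icc.uniformContinuousOn_of_continuous hcont
  rw [Metric.uniformContinuousOn_iff] at this
  obtain ⟨δ, hδ, h⟩ := this ε hε
  exact ⟨δ, hδ, fun s hs t ht hst => h s hs t ht hst⟩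

lemma ev_approx (hW : TendstoUniformlyOn
      (fun (n : ℕ) (s : ℝ) => (((τ n).lukas ⌊((n : ℝ) + 1) * s⌋₊ : ℤ) : ℝ) / B n)
      f atTop (Set.Icc 0 1)) {ε : ℝ} (hε : 0 < ε) :
    ∀ᶠ n in atTop, ∀ s ∈ Set.Icc (0 : ℝ) 1,
      |(((τ n).lukas ⌊((n : ℝ) + 1) * s⌋₊ : ℤ) : ℝ) / B n - f s| < ε := by
  filter_upwards [(Metric.tendstoUniformlyOn_iff.1 hW) ε hε] with n hn s hs
  have := hn s hs
  rw [dist_comm, Real.dist_eq] at this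
  exact this

lemma ev_height (hheight : Tendsto (fun n : ℕ => ((τ n).height : ℝ) / (n + 1)) atTop (nhds 0))
    {ε : ℝ} (hε : 0 < ε) :
    ∀ᶠ n : ℕ in atTop, (((τ n).height + 1 : ℕ) : ℝ) / (n + 1) < ε := by
  have h1 := hheight.add (tendsto_one_div_add_atTop_nhds_zero_nat (𝕜 := ℝ))
  rw [add_zero] at h1
  filter_upwards [h1.eventually_lt_const hε] with n hn
  push_cast
  rwa [add_div]

lemma ratio_mem {n j : ℕ} (hj : j ≤ n + 1) : (j : ℝ) / ((n : ℝ) + 1) ∈ Set.Icc (0 : ℝ) 1 := by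
  have : (j : ℝ) ≤ (n : ℝ) + 1 := by exact_mod_cast hj
  exact ⟨by positivity, (div_le_one (by positivity)).2 this⟩

lemma approx_idx {n : ℕ} {ε : ℝ} (h : ∀ s ∈ Set.Icc (0 : ℝ) 1,
      |(((τ n).lukas ⌊((n : ℝ) + 1) * s⌋₊ : ℤ) : ℝ) / B n - f s| < ε) {j : ℕ} (hj : j ≤ n + 1) :
    |(((τ n).lukas j : ℤ) : ℝ) / B n - f ((j : ℝ) / ((n : ℝ) + 1))| < ε := by
  have := h _ (ratio_mem hj)
  rwa [mul_div_cancel₀ _ (by positivity : (n : ℝ) + 1 ≠ 0), Nat.floor_natCast] at this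

lemma near_idx {n : ℕ} {ε δ : ℝ} {K : ℕ} (hu : ∀ s ∈ Set.Icc (0 : ℝ) 1, ∀ t ∈ Set.Icc (0 : ℝ) 1,
    |s - t| < δ → |f s - f t| < ε) (hK : (K : ℝ) / (n + 1) < δ) {i j : ℕ} (hi : i ≤ n + 1)
    (hj : j ≤ n + 1) (h1 : i ≤ j + K) (h2 : j ≤ i + K) :
    |f ((i : ℝ) / ((n : ℝ) + 1)) - f ((j : ℝ) / ((n : ℝ) + 1))| < ε := by
  apply hu _ (ratio_mem hi) _ (ratio_mem hj)
  rw [← sub_div, abs_div, abs_of_pos (by positivity : (0 : ℝ) < (n : ℝ) + 1)]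
  refine lt_of_le_of_lt ?_ hK
  gcongr
  have e1 : (i : ℝ) ≤ j + K := by exact_mod_cast h1
  have e2 : (j : ℝ) ≤ i + K := by exact_mod_cast h2
  rw [abs_le]; constructor <;> linarith

lemma edge_approx (hcont : ContinuousOn f (Set.Icc 0 1))
    (hshape : ∀ n : ℕ, IsShape (n + 1) (θ n) (τ n) (emb n))
    (hheight : Tendsto (fun n : ℕ => ((τ n).height : ℝ) / (n + 1)) atTop (nhds 0))
    (hB : Tendsto B atTop atTop)
    (hW : TendstoUniformlyOn
      (fun (n : ℕ) (s : ℝ) => (((τ n).lukas ⌊((n : ℝ) + 1) * s⌋₊ : ℤ) : ℝ) / B n)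
      f atTop (Set.Icc 0 1)) {η : ℝ} (hη : 0 < η) :
    ∀ᶠ n in atTop, ∀ x y : Fin (n + 1), (θ n).adj.Adj x y →
      |f ((x.val : ℝ) / ((n : ℝ) + 1)) - f ((y.val : ℝ) / ((n : ℝ) + 1))| ≤ η ∧
      ∀ z ∈ Set.Icc (min ((x.val : ℝ) / ((n : ℝ) + 1)) ((y.val : ℝ) / ((n : ℝ) + 1)))
        (max ((x.val : ℝ) / ((n : ℝ) + 1)) ((y.val : ℝ) / ((n : ℝ) + 1))),
        f ((x.val : ℝ) / ((n : ℝ) + 1)) - η ≤ f z := by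
  set ε := η / 10 with hεd
  have hε : 0 < ε := by positivity
  obtain ⟨δ, hδ, hu⟩ := unif_cont hcont hε
  filter_upwards [ev_approx hW hε, ev_height hheight hδ, hB.eventually_gt_atTop 0]
    with n happ hH hBn x y hxy
  obtain ⟨a, e, hae, hen, hge, hgx, hgy⟩ := combi_edge (hshape n) hxy
  set K := (τ n).height + 1 with hKd
  have hN : (0 : ℝ) < (n : ℝ) + 1 := by positivity
  set w : ℕ → ℝ := fun j => (((τ n).lukas j : ℤ) : ℝ) / B n with hw
  set g : ℕ → ℝ := fun j => f ((j : ℝ) / ((n : ℝ) + 1)) with hg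
  have wle : ∀ i j, (τ n).lukas i ≤ (τ n).lukas j → w i ≤ w j := by
    intro i j hij
    have : (((τ n).lukas i : ℤ) : ℝ) ≤ (((τ n).lukas j : ℤ) : ℝ) := by exact_mod_cast hij
    simp only [hw]; gcongr
  have wg : ∀ j, j ≤ n + 1 → |w j - g j| < ε := fun j hj => approx_idx happ hj
  have gg : ∀ i j, i ≤ n + 1 → j ≤ n + 1 → i ≤ j + K → j ≤ i + K → |g i - g j| < ε :=
    fun i j hi hj h1 h2 => near_idx hu hH hi hj h1 h2
  have up : ∀ p : ℕ, GoodPos (τ n) (n + 1) a e p → g p ≤ g a + 7 * ε := by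
    rintro p ⟨h1, h2, c, hc, b, hb, h3, h4, h5, h6⟩
    have t1 := abs_lt.1 (gg p b (by omega) hb (by omega) h6)
    have t2 := abs_lt.1 (wg b hb)
    have t3 := wle _ _ h4
    have t4 := abs_lt.1 (wg (c + 1) (by omega))
    have t5 := abs_lt.1 (gg (c + 1) c (by omega) (by omega) (by omega) (by omega))
    have t6 := abs_lt.1 (wg c (by omega))
    have t7 := wle _ _ h3
    have t8 := abs_lt.1 (wg (a + 1) (by omega))
    have t9 := abs_lt.1 (gg (a + 1) a (by omega) (by omega) (by omega) (by omega))
    linarith [t1.2, t2.1, t4.2, t5.2, t6.1, t8.2, t9.2]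
  have down : ∀ z : ℝ, 0 ≤ z → (a : ℝ) ≤ z * ((n : ℝ) + 1) + K → z * ((n : ℝ) + 1) < e →
      g a - 3 * ε ≤ f z := by
    intro z hz0 h1 h2
    have he : (e : ℝ) ≤ (n : ℝ) + 1 := by exact_mod_cast hen
    have hz1 : z ∈ Set.Icc (0 : ℝ) 1 := by
      refine ⟨hz0, ?_⟩
      by_contra hc
      nlinarith
    by_cases hza : (a : ℝ) ≤ z * ((n : ℝ) + 1)
    · have hj1 : a ≤ ⌊((n : ℝ) + 1) * z⌋₊ := Nat.le_floor (by linarith)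
      have hj2 : ⌊((n : ℝ) + 1) * z⌋₊ < e := (Nat.floor_lt (by positivity)).2 (by linarith)
      have t1 := abs_lt.1 (happ z hz1)
      have t2 := wle _ _ (hge _ hj1 hj2)
      have t3 := abs_lt.1 (wg a (by omega))
      simp only [hw] at t2 t3
      linarith [t1.2, t3.1]
    · have := abs_lt.1 (hu _ (ratio_mem (by omega : a ≤ n + 1)) z hz1 (by
        refine lt_of_le_of_lt ?_ hH
        have q1 : (a : ℝ) / ((n : ℝ) + 1) ≤ (z * ((n : ℝ) + 1) + K) / ((n : ℝ) + 1) := by gcongr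
        rw [add_div, mul_div_cancel_right₀ _ hN.ne'] at q1
        have q2 : z ≤ (a : ℝ) / ((n : ℝ) + 1) := by rw [le_div_iff₀ hN]; linarith
        rw [abs_of_nonneg (by linarith)]
        linarith))
      linarith [this.2]
  have posd : ∀ p : ℕ, GoodPos (τ n) (n + 1) a e p → (a : ℝ) ≤ p + K ∧ (p : ℝ) + 1 ≤ e := by
    rintro p ⟨h1, h2, -⟩
    exact ⟨by exact_mod_cast h1, by exact_mod_cast h2⟩
  have hx := posd _ hgx
  have hy := posd _ hgy
  have betw : ∀ z ∈ Set.Icc (min ((x.val : ℝ) / ((n : ℝ) + 1)) ((y.val : ℝ) / ((n : ℝ) + 1)))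
        (max ((x.val : ℝ) / ((n : ℝ) + 1)) ((y.val : ℝ) / ((n : ℝ) + 1))), g a - 3 * ε ≤ f z := by
    intro z hz
    have c1 := hz.1
    have c2 := hz.2
    rw [min_le_iff, div_le_iff₀ hN, div_le_iff₀ hN] at c1
    rw [le_max_iff, le_div_iff₀ hN, le_div_iff₀ hN] at c2
    refine down z ((le_min (by positivity) (by positivity)).trans hz.1) ?_ ?_
    · rcases c1 with c1 | c1 <;> linarith
    · rcases c2 with c2 | c2 <;> linarith
  have ux := up _ hgx
  have uy := up _ hgy
  have lx := betw ((x.val : ℝ) / ((n : ℝ) + 1)) ⟨min_le_left _ _, le_max_left _ _⟩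
  have ly := betw ((y.val : ℝ) / ((n : ℝ) + 1)) ⟨min_le_right _ _, le_max_right _ _⟩
  simp only [hg] at ux uy lx ly betw
  refine ⟨?_, fun z hz => ?_⟩
  · rw [abs_le]; constructor <;> linarith
  · have := betw z hz; linarith

lemma branch_approx (hcont : ContinuousOn f (Set.Icc 0 1))
    (hnn : ∀ s ∈ Set.Icc (0 : ℝ) 1, 0 ≤ f s)
    (hshape : ∀ n : ℕ, IsShape (n + 1) (θ n) (τ n) (emb n))
    (hheight : Tendsto (fun n : ℕ => ((τ n).height : ℝ) / (n + 1)) atTop (nhds 0))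
    (hB : Tendsto B atTop atTop)
    (hW : TendstoUniformlyOn
      (fun (n : ℕ) (s : ℝ) => (((τ n).lukas ⌊((n : ℝ) + 1) * s⌋₊ : ℤ) : ℝ) / B n)
      f atTop (Set.Icc 0 1)) {a b c d l l' : ℝ} (ha : 0 ≤ a) (hab : a ≤ b) (hbc : b < c)
    (hcd : c ≤ d) (hd : d ≤ 1) (hll : l < l') (hfa : f a ≤ l) (hfd : f d ≤ l)
    (hbcf : ∀ z ∈ Set.Icc b c, l' ≤ f z) {δ : ℝ} (hδ : 0 < δ) :
    ∀ᶠ n in atTop, ∃ x y : Fin (n + 1), (θ n).adj.Adj x y ∧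
      a - δ ≤ (x.val : ℝ) / ((n : ℝ) + 1) ∧ (x.val : ℝ) / ((n : ℝ) + 1) ≤ b ∧
      c - δ ≤ (y.val : ℝ) / ((n : ℝ) + 1) ∧ (y.val : ℝ) / ((n : ℝ) + 1) ≤ d := by
  set ε := (l' - l) / 20 with hεd
  have hε : 0 < ε := by have := sub_pos.2 hll; positivity
  have hl' : l' = l + 20 * ε := by rw [hεd]; ring
  obtain ⟨δ', hδ', hu⟩ := unif_cont hcont hε
  have hl0 : 0 ≤ l := (hnn a ⟨ha, by linarith⟩).trans hfa
  filter_upwards [ev_approx hW hε, ev_height hheight hδ', ev_height hheight (half_pos hδ),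
    hB.eventually_gt_atTop 0] with n happ hH hH2 hBn
  have hs := hshape n
  set T := τ n with hT
  have hcard : T.verts.card = n + 1 := hs.1
  have hN : (0 : ℝ) < (n : ℝ) + 1 := by positivity
  set w : ℕ → ℝ := fun j => ((T.lukas j : ℤ) : ℝ) / B n with hw
  set g : ℕ → ℝ := fun j => f ((j : ℝ) / ((n : ℝ) + 1)) with hg
  have wle : ∀ i j, T.lukas i ≤ T.lukas j → w i ≤ w j := by
    intro i j hij
    have : ((T.lukas i : ℤ) : ℝ) ≤ ((T.lukas j : ℤ) : ℝ) := by exact_mod_cast hij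
    simp only [hw]; gcongr
  have wlt : ∀ i j, w i < w j → T.lukas i < T.lukas j := by
    intro i j hij
    by_contra hc
    exact absurd (wle _ _ (not_lt.1 hc)) (not_le.2 hij)
  have wg : ∀ j, j ≤ n + 1 → |w j - g j| < ε := fun j hj => approx_idx happ hj
  have gg : ∀ i j, i ≤ n + 1 → j ≤ n + 1 → i ≤ j + (T.height + 1) → j ≤ i + (T.height + 1) →
      |g i - g j| < ε :=
    fun i j hi hj h1 h2 => near_idx hu hH hi hj h1 h2
  -- the point in the middle
  obtain ⟨r, hbr, hrc⟩ := exists_between hbc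
  have hr1 : r ∈ Set.Icc (0 : ℝ) 1 := ⟨by linarith, by linarith⟩
  set i := ⌊((n : ℝ) + 1) * r⌋₊ with hi
  have hiN : i < n + 1 := by
    rw [hi, Nat.floor_lt (by have := hr1.1; positivity)]
    push_cast
    nlinarith
  have hir : (i : ℝ) ≤ ((n : ℝ) + 1) * r := Nat.floor_le (by have := hr1.1; positivity)
  have hir2 : ((n : ℝ) + 1) * r < i + 1 := Nat.lt_floor_add_one _
  obtain ⟨v, hv, hvi⟩ := PlaneTree.idx_surj (τ := T) (j := i) (by omega)
  have wi : l' - ε < w i := by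
    have := abs_lt.1 (happ r hr1)
    have h2 := hbcf r ⟨hbr.le, hrc.le⟩
    simp only [hw, hi]
    linarith [this.1]
  have hvt : ∀ j, v.take j ∈ T.verts := fun j => T.prefix_closed _ _ (List.take_prefix j v) hv
  set I : ℕ → ℕ := fun j => T.idx (v.take j) with hI
  have hpre : ∀ i j, i ≤ j → v.take i <+: v.take j := fun i j hij =>
    List.take_prefix_take_left hij
  have Imono : ∀ p q, p ≤ q → I p ≤ I q := fun p q hpq =>
    PlaneTree.idx_mono (word_prefix_le (hpre p q hpq))
  have Wmono : ∀ p q, p ≤ q → w (I p) ≤ w (I q) := fun p q hpq =>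
    wle _ _ (PlaneTree.lukas_des_ge (hvt q) (hpre p q hpq))
  have Ilast : I v.length = i := by simp only [hI, List.take_length, hvi]
  have Ile : ∀ j, I j ≤ i := by
    intro j
    rw [← hvi]
    exact PlaneTree.idx_mono (word_prefix_le (List.take_prefix j v))
  have I0 : w (I 0) = 0 := by
    have : I 0 = 0 := by
      simp only [hI, List.take_zero, PlaneTree.idx, PlaneTree.low]
      simp
    rw [this]
    simp [hw, PlaneTree.lukas]
  have Istep : ∀ j, j < v.length → w (I (j + 1)) ≤ w (I j) + 3 * ε := by
    intro j hj
    have hm := hvt (j + 1)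
    have e : v.take (j + 1) = v.take j ++ [v[j]] := by rw [List.take_append_getElem]
    have h1 : w (I (j + 1)) ≤ w (I j + 1) := by
      apply wle
      simp only [hI]
      rw [e] at hm ⊢
      exact PlaneTree.lukas_child_le hm
    have hj := Ile j
    have t4 := abs_lt.1 (wg (I j + 1) (by omega))
    have t5 := abs_lt.1 (gg (I j + 1) (I j) (by omega) (by omega) (by omega) (by omega))
    have t6 := abs_lt.1 (wg (I j) (by omega))
    linarith [t4.2, t5.2, t6.1]
  -- confinement
  have conf : ∀ j, l + 5 * ε ≤ w (I j) → w (I j) ≤ l + 15 * ε →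
      a - δ / 2 ≤ (I j : ℝ) / ((n : ℝ) + 1) ∧ (I j : ℝ) / ((n : ℝ) + 1) ≤ b ∧
      c ≤ (T.fin (v.take j) : ℝ) / ((n : ℝ) + 1) ∧
        (T.fin (v.take j) : ℝ) / ((n : ℝ) + 1) ≤ d := by
    intro j h1 h2
    have hIj := Ile j
    have hfi : i < T.fin (v.take j) := by
      rw [← hvi]
      exact (PlaneTree.idx_lt_fin hv).trans_le (PlaneTree.fin_mono (List.take_prefix j v))
    have hfN : T.fin (v.take j) ≤ n + 1 := by rw [← hcard]; exact PlaneTree.fin_le_card _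
    refine ⟨?_, ?_, ?_, ?_⟩
    · have hfl : ⌊((n : ℝ) + 1) * a⌋₊ ≤ I j := by
        by_contra hc
        have hle : ⌊((n : ℝ) + 1) * a⌋₊ ≤ i := Nat.floor_mono (by
          apply mul_le_mul_of_nonneg_left _ hN.le; linarith)
        have := wle _ _ (PlaneTree.lukas_ge (τ := T) (u := v.take j)
          (j := ⌊((n : ℝ) + 1) * a⌋₊) (not_le.1 hc).le (by omega))
        have t := abs_lt.1 (happ a ⟨ha, by linarith⟩)
        simp only [hw, hI] at this h1
        linarith [t.2]
      have h3 : ((n : ℝ) + 1) * a < (⌊((n : ℝ) + 1) * a⌋₊ : ℝ) + 1 := Nat.lt_floor_add_one _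
      have h4 : ((⌊((n : ℝ) + 1) * a⌋₊ : ℕ) : ℝ) ≤ I j := by exact_mod_cast hfl
      rw [div_lt_iff₀ hN] at hH2
      have h5 : (1 : ℝ) ≤ ((T.height + 1 : ℕ) : ℝ) := by push_cast; linarith [Nat.cast_nonneg (α := ℝ) T.height]
      rw [le_div_iff₀ hN]
      linarith
    · by_contra hc
      have h3 : (I j : ℝ) / ((n : ℝ) + 1) ≤ c := by
        rw [div_le_iff₀ hN]
        have : (I j : ℝ) ≤ i := by exact_mod_cast hIj
        nlinarith
      have h4 := hbcf _ ⟨(not_le.1 hc).le, h3⟩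
      have t := abs_lt.1 (wg (I j) (by omega))
      simp only [hg] at t
      linarith [t.1]
    · by_contra hc
      have h3 : b ≤ (T.fin (v.take j) : ℝ) / ((n : ℝ) + 1) := by
        rw [le_div_iff₀ hN]
        have : (i : ℝ) + 1 ≤ T.fin (v.take j) := by exact_mod_cast hfi
        nlinarith
      have h4 := hbcf _ ⟨h3, (not_le.1 hc).le⟩
      have t := abs_lt.1 (wg _ hfN)
      have h5 := wle (T.fin (v.take j)) (I j) (by
        rw [PlaneTree.lukas_fin_eq (hvt j)]; simp only [hI]; omega)
      simp only [hg] at t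
      linarith [t.1]
    · have hfl : T.fin (v.take j) ≤ ⌊((n : ℝ) + 1) * d⌋₊ := by
        by_contra hc
        have hle : i ≤ ⌊((n : ℝ) + 1) * d⌋₊ := Nat.floor_mono (by
          apply mul_le_mul_of_nonneg_left _ hN.le; linarith)
        have := wle _ _ (PlaneTree.lukas_ge (τ := T) (u := v.take j)
          (j := ⌊((n : ℝ) + 1) * d⌋₊) (hIj.trans hle) (not_le.1 hc))
        have t := abs_lt.1 (happ d ⟨by linarith, hd⟩)
        simp only [hw, hI] at this h1
        linarith [t.2]
      have h3 : (⌊((n : ℝ) + 1) * d⌋₊ : ℝ) ≤ ((n : ℝ) + 1) * d :=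
        Nat.floor_le (mul_nonneg hN.le (by linarith))
      have h4 : (T.fin (v.take j) : ℝ) ≤ (⌊((n : ℝ) + 1) * d⌋₊ : ℕ) := by exact_mod_cast hfl
      rw [div_le_iff₀ hN]
      linarith
  -- the two generations
  classical
  have ex0 : ∃ j, l + 5 * ε ≤ w (I j) := ⟨v.length, by rw [Ilast]; linarith⟩
  have ex1 : ∃ j, l + 15 * ε < w (I j) := ⟨v.length, by rw [Ilast]; linarith⟩
  obtain ⟨j₀, hj0a, hj0b⟩ : ∃ j, l + 5 * ε ≤ w (I j) ∧ w (I j) ≤ l + 8 * ε := by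
    refine ⟨Nat.find ex0, Nat.find_spec ex0, ?_⟩
    have hlen : Nat.find ex0 ≤ v.length := Nat.find_min' ex0 (by rw [Ilast]; linarith)
    rcases h : Nat.find ex0 with _ | k
    · rw [I0]; linarith
    · have h1 := Nat.find_min ex0 (m := k) (by omega)
      have h2 := Istep k (by omega)
      push Not at h1
      linarith
  obtain ⟨j₁, hj1a, hj1b, hj1l⟩ : ∃ j, l + 12 * ε ≤ w (I j) ∧ w (I j) ≤ l + 15 * ε ∧
      j ≤ v.length := by
    have hlen : Nat.find ex1 ≤ v.length := Nat.find_min' ex1 (by rw [Ilast]; linarith)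
    have hsp := Nat.find_spec ex1
    rcases h : Nat.find ex1 with _ | k
    · rw [h, I0] at hsp; linarith
    · have h1 := Nat.find_min ex1 (m := k) (by omega)
      have h2 := Istep k (by omega)
      rw [h] at hsp
      push Not at h1
      exact ⟨k, by linarith, h1, by omega⟩
  have hjj : j₀ < j₁ := by
    by_contra hc
    have := Wmono _ _ (not_lt.1 hc)
    linarith
  have hii : I j₀ + T.height < I j₁ := by
    by_contra hc
    have i0 := Ile j₀
    have i1 := Ile j₁
    have im := Imono _ _ hjj.le
    have t1 := abs_lt.1 (gg (I j₀) (I j₁) (by omega) (by omega) (by omega) (by omega))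
    have t2 := abs_lt.1 (wg (I j₀) (by omega))
    have t3 := abs_lt.1 (wg (I j₁) (by omega))
    linarith [t1.1, t1.2, t2.1, t2.2, t3.1, t3.2]
  obtain ⟨x, y, hxy, h1, h2, h3, h4⟩ := combi_branch hs hv hjj hj1l
    (wlt _ _ (by change w (I j₀) < w (I j₁); linarith)) hii
  obtain ⟨p1, p2, p3, p4⟩ := conf j₀ hj0a (by linarith)
  obtain ⟨q1, q2, q3, q4⟩ := conf j₁ (by linarith) hj1b
  have h1' : ((T.idx (v.take j₀) : ℕ) : ℝ) ≤ x.val + ((T.height + 1 : ℕ) : ℝ) := by exact_mod_cast h1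
  have h2' : (x.val : ℝ) ≤ (T.idx (v.take j₁) : ℕ) := by exact_mod_cast h2
  have h3' : ((T.fin (v.take j₁) : ℕ) : ℝ) ≤ y.val + ((T.height + 1 : ℕ) : ℝ) := by exact_mod_cast h3
  have h4' : (y.val : ℝ) ≤ (T.fin (v.take j₀) : ℕ) := by exact_mod_cast h4
  simp only [hI] at p1 q2
  rw [le_div_iff₀ hN] at p1 q3
  rw [div_le_iff₀ hN] at q2 p4
  rw [div_lt_iff₀ hN] at hH2
  refine ⟨x, y, hxy, ?_, ?_, ?_, ?_⟩
  · rw [le_div_iff₀ hN]; linarith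
  · rw [div_le_iff₀ hN]; linarith
  · have : 0 < δ * ((n : ℝ) + 1) := by positivity
    rw [le_div_iff₀ hN]; linarith
  · rw [div_le_iff₀ hN]; linarith

end Conv

/-! ### Final assembly -/

section Final

variable {f : ℝ → ℝ}

lemma no_two_min
    (hHf : ∀ a b c d : ℝ, 0 ≤ a → a < b → b < c → c < d → d ≤ 1 →
      (∃ x ∈ Set.Ioo a b, f x = sInf (f '' Set.Ioo a b)) →
      (∃ y ∈ Set.Ioo c d, f y = sInf (f '' Set.Ioo c d)) →
      sInf (f '' Set.Ioo a b) ≠ sInf (f '' Set.Ioo c d))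
    {a x y d : ℝ} (ha : 0 ≤ a) (hax : a < x) (hxy : x < y) (hyd : y < d) (hd : d ≤ 1)
    (he : f x = f y) (hmin : ∀ z ∈ Set.Ioo a d, f x ≤ f z) : False := by
  have key : ∀ p q w : ℝ, a ≤ p → q ≤ d → w ∈ Set.Ioo p q → f w = f x →
      f w = sInf (f '' Set.Ioo p q) := by
    intro p q w hp hq hw hfw
    have hL : IsLeast (f '' Set.Ioo p q) (f w) :=
      ⟨⟨w, hw, rfl⟩, by
        rintro _ ⟨z, hz, rfl⟩
        rw [hfw]
        exact hmin z ⟨hp.trans_lt hz.1, hz.2.trans_le hq⟩⟩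
    exact hL.csInf_eq.symm
  have hx : x ∈ Set.Ioo a (x + (y - x) / 3) := ⟨hax, by linarith⟩
  have hy : y ∈ Set.Ioo (y - (y - x) / 3) d := ⟨by linarith, hyd⟩
  have k1 := key a (x + (y - x) / 3) x le_rfl (by linarith) hx rfl
  have k2 := key (y - (y - x) / 3) d y (by linarith) le_rfl hy he.symm
  exact hHf a (x + (y - x) / 3) (y - (y - x) / 3) d ha (by linarith) (by linarith) (by linarith) hd
    ⟨x, hx, k1⟩ ⟨y, hy, k2⟩ (by rw [← k1, ← k2, he])

variable {θ : ∀ n : ℕ, NCTree (n + 1)} {τ : ℕ → PlaneTree}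
  {emb : ∀ n : ℕ, List ℕ → Fin (n + 1)} {B : ℕ → ℝ}

lemma pair_approx
    (hcont : ContinuousOn f (Set.Icc 0 1))
    (hf0 : f 0 = 0) (hf1 : f 1 = 0)
    (hnn : ∀ s ∈ Set.Icc (0 : ℝ) 1, 0 ≤ f s)
    (hHf : ∀ a b c d : ℝ, 0 ≤ a → a < b → b < c → c < d → d ≤ 1 →
      (∃ x ∈ Set.Ioo a b, f x = sInf (f '' Set.Ioo a b)) →
      (∃ y ∈ Set.Ioo c d, f y = sInf (f '' Set.Ioo c d)) →
      sInf (f '' Set.Ioo a b) ≠ sInf (f '' Set.Ioo c d))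
    (hshape : ∀ n : ℕ, IsShape (n + 1) (θ n) (τ n) (emb n))
    (hheight : Tendsto (fun n : ℕ => ((τ n).height : ℝ) / (n + 1)) atTop (nhds 0))
    (hB : Tendsto B atTop atTop)
    (hW : TendstoUniformlyOn
      (fun (n : ℕ) (s : ℝ) => (((τ n).lukas ⌊((n : ℝ) + 1) * s⌋₊ : ℤ) : ℝ) / B n)
      f atTop (Set.Icc 0 1))
    {s t δ : ℝ} (hs : s ∈ Set.Icc (0 : ℝ) 1) (ht : t ∈ Set.Icc (0 : ℝ) 1) (hst : s < t)
    (h01 : ¬ (s = 0 ∧ t = 1)) (hrel : relF f s t) (hδ : 0 < δ) :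
    ∀ᶠ n in atTop, ∃ x y : Fin (n + 1), (θ n).adj.Adj x y ∧
      |s - (x.val : ℝ) / ((n : ℝ) + 1)| ≤ δ ∧ |t - (y.val : ℝ) / ((n : ℝ) + 1)| ≤ δ := by
  have hle : ∀ z ∈ Set.Icc s t, f s ≤ f z := by
    intro z hz
    refine relF_le hnn hs ht hrel ?_
    rwa [min_eq_left hst.le, max_eq_right hst.le]
  have heq : f s = f t := hrel.1
  by_cases hA : ∀ z ∈ Set.Ioo s t, f z ≠ f s
  · set e := min (δ / 2) ((t - s) / 3) with he
    have e0 : 0 < e := lt_min (by linarith) (by linarith)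
    have e1 : e ≤ δ / 2 := min_le_left _ _
    have e2 : e ≤ (t - s) / 3 := min_le_right _ _
    obtain ⟨m, hm, hmin⟩ := (isCompact_Icc : IsCompact (Set.Icc (s + e) (t - e))).exists_isMinOn
      ⟨s + e, by constructor <;> linarith⟩
      (hcont.mono (fun z hz => ⟨by linarith [hs.1, hz.1], by linarith [ht.2, hz.2]⟩))
    have hlt : f s < f m := lt_of_le_of_ne (hle m ⟨by linarith [hm.1], by linarith [hm.2]⟩)
      (hA m ⟨by linarith [hm.1], by linarith [hm.2]⟩).symm
    filter_upwards [branch_approx hcont hnn hshape hheight hB hW (a := s) (b := s + e)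
      (c := t - e) (d := t) (l := f s) (l' := f m) hs.1 (by linarith) (by linarith) (by linarith)
      ht.2 hlt le_rfl heq.symm.le (fun z hz => hmin hz) (half_pos hδ)] with n hn
    obtain ⟨x, y, hxy, h1, h2, h3, h4⟩ := hn
    refine ⟨x, y, hxy, ?_, ?_⟩ <;> rw [abs_le] <;> constructor <;> linarith
  · push Not at hA
    obtain ⟨m, hm, hfm⟩ := hA
    have hs0 : 0 < s := by
      rcases hs.1.lt_or_eq with h | h
      · exact h
      exfalso
      have ht1 : t < 1 := lt_of_le_of_ne ht.2 (fun h' => h01 ⟨h.symm, h'⟩)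
      refine no_two_min hHf (a := s) (x := m) (y := t) (d := 1) hs.1 hm.1 hm.2 ht1 le_rfl
        (hfm.trans heq) ?_
      intro z hz
      rw [hfm, ← h, hf0]
      exact hnn z ⟨by linarith [hz.1, hs.1], hz.2.le⟩
    obtain ⟨a, ha0, has, haδ, hfa⟩ : ∃ a, 0 ≤ a ∧ a < s ∧ s - δ / 2 < a ∧ f a < f s := by
      by_contra hc
      push Not at hc
      refine no_two_min hHf (a := max 0 (s - δ / 2)) (x := s) (y := m) (d := t) (le_max_left _ _)
        (max_lt hs0 (by linarith)) hm.1 hm.2 ht.2 hfm.symm ?_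
      intro z hz
      by_cases hzs : z < s
      · exact hc z ((le_max_left _ _).trans hz.1.le) hzs ((le_max_right _ _).trans_lt hz.1)
      · exact hle z ⟨not_lt.1 hzs, hz.2.le⟩
    have hfs : 0 < f s := (hnn a ⟨ha0, by linarith [hs.2]⟩).trans_lt hfa
    have ht1 : t < 1 := by
      refine lt_of_le_of_ne ht.2 ?_
      rintro rfl
      linarith
    obtain ⟨d, hd1, htd, hdδ, hfd⟩ : ∃ d, d ≤ 1 ∧ t < d ∧ d < t + δ / 2 ∧ f d < f s := by
      by_contra hc
      push Not at hc
      refine no_two_min hHf (a := s) (x := m) (y := t) (d := min 1 (t + δ / 2)) hs.1 hm.1 hm.2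
        (lt_min ht1 (by linarith)) (min_le_left _ _) (hfm.trans heq) ?_
      intro z hz
      rw [hfm]
      by_cases hzs : t < z
      · exact hc z (hz.2.le.trans (min_le_left _ _)) hzs (hz.2.trans_le (min_le_right _ _))
      · exact hle z ⟨hz.1.le, not_lt.1 hzs⟩
    filter_upwards [branch_approx hcont hnn hshape hheight hB hW (a := a) (b := s)
      (c := t) (d := d) (l := max (f a) (f d)) (l' := f s) ha0 has.le hst htd.le hd1
      (max_lt hfa hfd) (le_max_left _ _) (le_max_right _ _) hle (half_pos hδ)] with n hn
    obtain ⟨x, y, hxy, h1, h2, h3, h4⟩ := hn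
    refine ⟨x, y, hxy, ?_, ?_⟩ <;> rw [abs_le] <;> constructor <;> linarith

lemma vertex_approx
    (hshape : ∀ n : ℕ, IsShape (n + 1) (θ n) (τ n) (emb n))
    {s δ : ℝ} (hs : s ∈ Set.Icc (0 : ℝ) 1) (hδ : 0 < δ) :
    ∀ᶠ n in atTop, ∃ z ∈ ncSet (n + 1) (θ n), dist (cpt s) z ≤ 7 * δ := by
  have h1 := (tendsto_one_div_add_atTop_nhds_zero_nat (𝕜 := ℝ)).eventually_lt_const (half_pos hδ)
  filter_upwards [h1, eventually_ge_atTop 1] with n hn hn1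
  have hN : (0 : ℝ) < (n : ℝ) + 1 := by positivity
  have hn1' : (1 : ℝ) ≤ n := by exact_mod_cast hn1
  set k := max 1 ⌊(n : ℝ) * s⌋₊ with hk
  have hkn : k ≤ n := by
    refine max_le hn1 ?_
    apply Nat.floor_le_of_le
    nlinarith [hs.2]
  have hk1 : 1 ≤ k := le_max_left _ _
  have b1 : (n : ℝ) * s ≤ k + 1 := by
    have a1 := (Nat.lt_floor_add_one ((n : ℝ) * s)).le
    have a2 : ((⌊(n : ℝ) * s⌋₊ : ℕ) : ℝ) ≤ k := by exact_mod_cast le_max_right _ _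
    linarith
  have b2 : (k : ℝ) ≤ n * s + 1 := by
    have a0 : 0 ≤ (n : ℝ) * s := mul_nonneg (by positivity) hs.1
    have a1 := Nat.floor_le a0
    rw [hk]
    push_cast
    exact max_le (by linarith) (by linarith)
  obtain ⟨-, hbij, h0, hadj, -, -⟩ := hshape n
  obtain ⟨u, hu, huk⟩ := hbij.surjOn (Set.mem_univ (⟨k, by omega⟩ : Fin (n + 1)))
  have hu0 : u ≠ [] := by
    rintro rfl
    rw [huk] at h0
    simp at h0
    omega
  have hA := hadj u hu hu0
  refine ⟨cpt ((k : ℝ) / ((n : ℝ) + 1)), ?_, ?_⟩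
  · refine mem_ncSet hA ?_
    rw [huk]
    push_cast
    exact right_mem_segment ℝ _ _
  · refine (cpt_dist _ _).trans ?_
    have : |s - (k : ℝ) / ((n : ℝ) + 1)| ≤ 2 * (1 / ((n : ℝ) + 1)) := by
      have e : s - (k : ℝ) / ((n : ℝ) + 1) = (s * (n + 1) - k) / ((n : ℝ) + 1) := by field_simp
      rw [e, abs_div, abs_of_pos hN, mul_one_div]
      gcongr
      rw [abs_le]; constructor <;> linarith [hs.1, hs.2]
    linarith

end Final

/-- **Proposition 12.** Let `f : [0,1] → ℝ₊` be continuous with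
`f(0) = f(1) = 0` and distinct local minima (H_f). If `θ_n` are noncrossing trees with `n`
vertices and shapes `τ_n` such that `H(τ_n)/n → 0` and the rescaled Łukasiewicz paths
`W_{⌊ns⌋}(τ_n)/B_n` converge uniformly on `[0,1]` to `f` for some `B_n → ∞`, then the `θ_n`,
viewed as compact subsets of the closed unit disk, converge to `L(f)` for the Hausdorff
distance. -/
theorem ncTree_tendsto_triangulation_continuous (f : ℝ → ℝ)
    (hcont : ContinuousOn f (Set.Icc 0 1)) (hf0 : f 0 = 0) (hf1 : f 1 = 0)
    (hnn : ∀ s ∈ Set.Icc (0 : ℝ) 1, 0 ≤ f s)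
    (hHf : ∀ a b c d : ℝ, 0 ≤ a → a < b → b < c → c < d → d ≤ 1 →
      (∃ x ∈ Set.Ioo a b, f x = sInf (f '' Set.Ioo a b)) →
      (∃ y ∈ Set.Ioo c d, f y = sInf (f '' Set.Ioo c d)) →
      sInf (f '' Set.Ioo a b) ≠ sInf (f '' Set.Ioo c d))
    (θ : ∀ n : ℕ, NCTree (n + 1)) (τ : ℕ → PlaneTree)
    (emb : ∀ n : ℕ, List ℕ → Fin (n + 1))
    (hshape : ∀ n : ℕ, IsShape (n + 1) (θ n) (τ n) (emb n))
    (hheight : Tendsto (fun n : ℕ => ((τ n).height : ℝ) / (n + 1)) atTop (nhds 0))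
    (B : ℕ → ℝ) (hB : Tendsto B atTop atTop)
    (hW : TendstoUniformlyOn
      (fun (n : ℕ) (s : ℝ) => (((τ n).lukas ⌊((n : ℝ) + 1) * s⌋₊ : ℤ) : ℝ) / B n)
      f atTop (Set.Icc 0 1)) :
    Tendsto (fun n : ℕ => Metric.hausdorffDist (ncSet (n + 1) (θ n)) (lamF f))
      atTop (nhds 0) := by
  -- pointwise approximation of the lamination by the trees
  have point : ∀ x ∈ lamF f, ∀ ε > 0, ∀ᶠ n in atTop,
      ∃ y ∈ ncSet (n + 1) (θ n), dist x y ≤ ε := by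
    intro x hx ε hε
    simp only [lamF, Set.mem_iUnion] at hx
    obtain ⟨⟨s, t⟩, ⟨hs, ht, hrel⟩, hx⟩ := hx
    simp only at hs ht hrel hx
    have h7 : 0 < ε / 7 := by positivity
    have h77 : 7 * (ε / 7) = ε := by ring
    have c01 : cpt 1 = cpt 0 := by
      unfold cpt
      have : -(2 * (Real.pi : ℂ) * Complex.I) * ((1 : ℝ) : ℂ) = -(2 * (Real.pi : ℂ) * Complex.I) := by
        push_cast; ring
      rw [this, Complex.exp_neg, Complex.exp_two_pi_mul_I]
      simp
    have degen : cpt s = cpt t → ∀ᶠ n in atTop,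
        ∃ y ∈ ncSet (n + 1) (θ n), dist x y ≤ ε := by
      intro h
      have hxs : x = cpt s := by
        unfold chord at hx
        rw [← h, segment_same] at hx
        exact hx
      rw [hxs, ← h77]
      exact vertex_approx hshape hs h7
    have gen : ∀ s t : ℝ, s ∈ Set.Icc (0 : ℝ) 1 → t ∈ Set.Icc (0 : ℝ) 1 → s < t →
        ¬ (s = 0 ∧ t = 1) → relF f s t → x ∈ chord s t → ∀ᶠ n in atTop,
        ∃ y ∈ ncSet (n + 1) (θ n), dist x y ≤ ε := by
      intro s t hs ht hst h01 hrel hx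
      filter_upwards [pair_approx hcont hf0 hf1 hnn hHf hshape hheight hB hW hs ht hst h01 hrel h7]
        with n hn
      obtain ⟨u, v, huv, h1, h2⟩ := hn
      obtain ⟨y, hy, hd⟩ := chord_near h1 h2 hx
      refine ⟨y, mem_ncSet huv ?_, by linarith⟩
      push_cast
      exact hy
    rcases lt_trichotomy s t with h | h | h
    · by_cases h01 : s = 0 ∧ t = 1
      · exact degen (by rw [h01.1, h01.2, c01])
      · exact gen s t hs ht h h01 hrel hx
    · exact degen (by rw [h])
    · by_cases h01 : t = 0 ∧ s = 1
      · exact degen (by rw [h01.1, h01.2, c01])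
      · refine gen t s ht hs h h01 ⟨hrel.1.symm, ?_⟩ (by rwa [chord_symm])
        rw [min_comm, max_comm, ← hrel.1]
        exact hrel.2
  have hbd : TotallyBounded (lamF f) := by
    refine (isCompact_closedBall (0 : ℂ) 1).totallyBounded.subset ?_
    intro x hx
    simp only [lamF, Set.mem_iUnion] at hx
    obtain ⟨⟨s, t⟩, -, hx⟩ := hx
    refine (convex_closedBall (0 : ℂ) 1).segment_subset ?_ ?_ hx <;>
      simp [norm_cpt]
  have main : ∀ ε > 0, ∀ᶠ n in atTop,
      Metric.hausdorffDist (ncSet (n + 1) (θ n)) (lamF f) ≤ ε := by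
    intro ε hε
    have h7 : 0 < ε / 7 := by positivity
    have h77 : 7 * (ε / 7) = ε := by ring
    obtain ⟨δ, hδ, hcomp⟩ := relF_compact hcont h7
    obtain ⟨net, hsub, hfin, hcov⟩ :=
      Metric.finite_approx_of_totallyBounded hbd (ε / 2) (half_pos hε)
    have hnet : ∀ᶠ n in atTop, ∀ x ∈ net, ∃ y ∈ ncSet (n + 1) (θ n), dist x y ≤ ε / 2 :=
      (Filter.eventually_all_finite hfin).2 (fun x hx => point x (hsub hx) _ (half_pos hε))
    filter_upwards [hnet, edge_approx hcont hshape hheight hB hW hδ] with n h1 h2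
    refine Metric.hausdorffDist_le_of_mem_dist hε.le ?_ ?_
    · intro z hz
      simp only [ncSet, Set.mem_iUnion] at hz
      obtain ⟨x, y, hxy, hz⟩ := hz
      rw [ncPos_eq_cpt, ncPos_eq_cpt] at hz
      push_cast at hz
      obtain ⟨e1, e2⟩ := h2 x y hxy
      obtain ⟨p, hp, q, hq, hr, d1, d2⟩ := hcomp _ (ratio_mem x.isLt.le) _ (ratio_mem y.isLt.le) e1 e2
      obtain ⟨w, hw, hd⟩ := chord_near d1 d2 hz
      refine ⟨w, ?_, by linarith⟩
      simp only [lamF, Set.mem_iUnion]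
      exact ⟨(p, q), ⟨hp, hq, hr⟩, hw⟩
    · intro x hx
      have := hcov hx
      simp only [Set.mem_iUnion, Metric.mem_ball] at this
      obtain ⟨y, hy, hxy⟩ := this
      obtain ⟨z, hz, hyz⟩ := h1 y hy
      exact ⟨z, hz, by linarith [dist_triangle x y z]⟩
  rw [Metric.tendsto_atTop']
  intro ε hε
  obtain ⟨N, hN⟩ := eventually_atTop.1 (main (ε / 2) (half_pos hε))
  refine ⟨N, fun n hn => ?_⟩
  rw [Real.dist_eq, sub_zero, abs_of_nonneg Metric.hausdorffDist_nonneg]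
  linarith [hN n hn.le]

end
end

section
/- Let θ be a noncrossing tree with n vertices and shape τ, let ∅ = u_0 ≺ … ≺ u_{n−1} be the vertices of τ in lexicographical order, and for 0 ≤ k ≤ n−1 let S_k be the number of strict descendants of u_k in τ and let P_k ∈ {0,1,…,n−1} be such that the vertex of θ corresponding to u_k is the complex number e^{−2iπP_k/n}. Then |k − P_k| ≤ H(τ) + S_k. -/
open Filter Set

lemma nc_ar_pos (x y z : ℝ) (hxy : x < y) (hyz : y < z) (hz : z < x + 2 * Real.pi) :
    0 < Real.sin (y - x) + Real.sin (z - y) - Real.sin (z - x) := by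
  have key : Real.sin (y - x) + Real.sin (z - y) - Real.sin (z - x) =
      4 * Real.sin ((y - x) / 2) * Real.sin ((z - y) / 2) * Real.sin ((z - x) / 2) := by
    have e1 : y - x = 2 * ((y - x) / 2) := by ring
    have e2 : z - y = 2 * ((z - y) / 2) := by ring
    have e3 : z - x = 2 * ((y - x) / 2 + (z - y) / 2) := by ring
    have e4 : (z - x) / 2 = (y - x) / 2 + (z - y) / 2 := by ring
    rw [e4]
    rw [e3]
    conv_lhs => rw [e1, e2]
    generalize h1 : (2 * ((y - x) / 2)) / 2 = p'
    have e5 : p' = (y - x) / 2 := by rw [← h1]; ring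
    generalize h2 : (2 * ((z - y) / 2)) / 2 = q'
    have e6 : q' = (z - y) / 2 := by rw [← h2]; ring
    subst e5 e6
    generalize (y - x) / 2 = p
    generalize (z - y) / 2 = q
    rw [Real.sin_two_mul, Real.sin_two_mul, Real.sin_two_mul, Real.sin_add, Real.cos_add]
    have h1 := Real.sin_sq_add_cos_sq p
    have h2 := Real.sin_sq_add_cos_sq q
    have c1 : Real.cos p ^ 2 = 1 - Real.sin p ^ 2 := by linarith
    have c2 : Real.cos q ^ 2 = 1 - Real.sin q ^ 2 := by linarith
    ring_nf
    rw [c1, c2]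
    ring
  rw [key]
  have p1 : 0 < Real.sin ((y - x) / 2) := Real.sin_pos_of_pos_of_lt_pi (by linarith) (by linarith)
  have p2 : 0 < Real.sin ((z - y) / 2) := Real.sin_pos_of_pos_of_lt_pi (by linarith) (by linarith)
  have p3 : 0 < Real.sin ((z - x) / 2) := Real.sin_pos_of_pos_of_lt_pi (by linarith) (by linarith)
  positivity

noncomputable def ncAng (n k : ℕ) : ℝ := 2 * Real.pi * k / n

lemma ncPos_eq (n k : ℕ) : ncPos n k = ⟨Real.cos (ncAng n k), -Real.sin (ncAng n k)⟩ := by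
  have : -(2 * Real.pi * Complex.I) * k / n = ((-ncAng n k : ℝ) : ℂ) * Complex.I := by
    unfold ncAng; push_cast; ring
  unfold ncPos
  rw [this]
  apply Complex.ext
  · rw [Complex.exp_ofReal_mul_I_re]; simp
  · rw [Complex.exp_ofReal_mul_I_im]; simp

lemma ncAng_lt {n a b : ℕ} (hn : 0 < n) (h : a < b) : ncAng n a < ncAng n b := by
  unfold ncAng
  have : (a : ℝ) < b := by exact_mod_cast h
  have h2 : (0 : ℝ) < n := by exact_mod_cast hn
  have := Real.pi_pos
  gcongr

lemma ncAng_lt_two_pi {n a b : ℕ} (h : b < n) : ncAng n b < ncAng n a + 2 * Real.pi := by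
  have h2 : (0 : ℝ) < n := by exact_mod_cast (by omega : 0 < n)
  have h0 : 0 ≤ ncAng n a := by unfold ncAng; have := Real.pi_pos; positivity
  have : ncAng n b < 2 * Real.pi := by
    unfold ncAng
    rw [div_lt_iff₀ h2]
    have : (b : ℝ) < n := by exact_mod_cast h
    have := Real.pi_pos
    gcongr
  linarith

lemma ncPos_inj {n a b : ℕ} (ha : a < b) (hb : b < n) : ncPos n a ≠ ncPos n b := by
  intro h
  rw [ncPos_eq, ncPos_eq, Complex.mk.injEq] at h
  obtain ⟨h1, h2⟩ := h
  have h2 : Real.sin (ncAng n a) = Real.sin (ncAng n b) := by linarith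
  have l1 := ncAng_lt (n := n) (by omega) ha
  have l2 := ncAng_lt_two_pi (n := n) (a := a) hb
  have hc : Real.cos (ncAng n b - ncAng n a) = 1 := by
    rw [Real.cos_sub, h1, h2]; nlinarith [Real.sin_sq_add_cos_sq (ncAng n b)]
  rw [Real.cos_eq_one_iff_of_lt_of_lt (by linarith [Real.pi_pos]) (by linarith)] at hc
  linarith

lemma ncPos_inj' {n a b : ℕ} (ha : a < n) (hb : b < n) (h : ncPos n a = ncPos n b) : a = b := by
  rcases lt_trichotomy a b with h1 | h1 | h1
  · exact absurd h (ncPos_inj h1 hb)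
  · exact h1
  · exact absurd h.symm (ncPos_inj h1 ha)

lemma nc_cross {n a c b d : ℕ} (h1 : a < c) (h2 : c < b) (h3 : b < d) (hd : d < n) :
    (segment ℝ (ncPos n a) (ncPos n b) ∩ segment ℝ (ncPos n c) (ncPos n d)).Nonempty := by
  have hn : 0 < n := by omega
  have l1 := ncAng_lt hn h1
  have l2 := ncAng_lt hn h2
  have l3 := ncAng_lt hn h3
  have l4 : ncAng n d < ncAng n a + 2 * Real.pi := ncAng_lt_two_pi hd
  rw [ncPos_eq, ncPos_eq, ncPos_eq, ncPos_eq]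
  generalize ncAng n a = x1 at *
  generalize ncAng n c = x2 at *
  generalize ncAng n b = x3 at *
  generalize ncAng n d = x4 at *
  have w1 := nc_ar_pos x2 x3 x4 l2 l3 (by linarith)
  have w3 := nc_ar_pos x1 x2 x4 l1 (by linarith) (by linarith)
  have w2 := nc_ar_pos x1 x3 x4 (by linarith) l3 (by linarith)
  have w4 := nc_ar_pos x1 x2 x3 l1 l2 (by linarith)
  have hs : (Real.sin (x3 - x2) + Real.sin (x4 - x3) - Real.sin (x4 - x2)) +
      (Real.sin (x2 - x1) + Real.sin (x4 - x2) - Real.sin (x4 - x1)) =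
      (Real.sin (x3 - x1) + Real.sin (x4 - x3) - Real.sin (x4 - x1)) +
      (Real.sin (x2 - x1) + Real.sin (x3 - x2) - Real.sin (x3 - x1)) := by ring
  have hcos : (Real.sin (x3 - x2) + Real.sin (x4 - x3) - Real.sin (x4 - x2)) * Real.cos x1 +
      (Real.sin (x2 - x1) + Real.sin (x4 - x2) - Real.sin (x4 - x1)) * Real.cos x3 =
      (Real.sin (x3 - x1) + Real.sin (x4 - x3) - Real.sin (x4 - x1)) * Real.cos x2 +
      (Real.sin (x2 - x1) + Real.sin (x3 - x2) - Real.sin (x3 - x1)) * Real.cos x4 := by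
    simp only [Real.sin_sub]; ring
  have hsin : (Real.sin (x3 - x2) + Real.sin (x4 - x3) - Real.sin (x4 - x2)) * Real.sin x1 +
      (Real.sin (x2 - x1) + Real.sin (x4 - x2) - Real.sin (x4 - x1)) * Real.sin x3 =
      (Real.sin (x3 - x1) + Real.sin (x4 - x3) - Real.sin (x4 - x1)) * Real.sin x2 +
      (Real.sin (x2 - x1) + Real.sin (x3 - x2) - Real.sin (x3 - x1)) * Real.sin x4 := by
    simp only [Real.sin_sub]; ring
  generalize (Real.sin (x3 - x2) + Real.sin (x4 - x3) - Real.sin (x4 - x2)) = a1 at *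
  generalize (Real.sin (x2 - x1) + Real.sin (x4 - x2) - Real.sin (x4 - x1)) = a3 at *
  generalize (Real.sin (x3 - x1) + Real.sin (x4 - x3) - Real.sin (x4 - x1)) = a2 at *
  generalize (Real.sin (x2 - x1) + Real.sin (x3 - x2) - Real.sin (x3 - x1)) = a4 at *
  have hp : 0 < a1 + a3 := by linarith
  have hp' : 0 < a2 + a4 := by linarith
  refine ⟨(a1 / (a1 + a3)) • (⟨Real.cos x1, -Real.sin x1⟩ : ℂ) +
    (a3 / (a1 + a3)) • (⟨Real.cos x3, -Real.sin x3⟩ : ℂ),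
    ⟨_, _, by positivity, by positivity, by field_simp, rfl⟩,
    ⟨a2 / (a2 + a4), a4 / (a2 + a4), by positivity, by positivity, by field_simp, ?_⟩⟩
  rw [hs]
  apply Complex.ext
  · simp only [Complex.add_re, Complex.add_im, Complex.smul_re, Complex.smul_im, smul_eq_mul]
    field_simp
    linarith
  · simp only [Complex.add_re, Complex.add_im, Complex.smul_re, Complex.smul_im, smul_eq_mul]
    field_simp
    linarith

lemma nc_nocross {n : ℕ} (θ : NCTree n) (a c b d : Fin n) (h1 : a < c) (h2 : c < b) (h3 : b < d)
    (hab : θ.adj.Adj a b) (hcd : θ.adj.Adj c d) : False := by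
  obtain ⟨z, hz⟩ := nc_cross (n := n) (a := a) (c := c) (b := b) (d := d) h1 h2 h3 d.2
  have hne : ({(a : ℕ), (b : ℕ)} : Set ℕ) ≠ {(c : ℕ), (d : ℕ)} := by
    intro h
    have : (a : ℕ) ∈ ({(c : ℕ), (d : ℕ)} : Set ℕ) := by rw [← h]; simp
    simp at this
    omega
  obtain ⟨h4, h5⟩ := θ.noncrossing a b c d hab hcd hne hz
  rcases h4 with h4 | h4 <;> rcases h5 with h5 | h5 <;>
  · have := ncPos_inj' (Fin.is_lt _) (Fin.is_lt _) (h4.symm.trans h5)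
    omega

/-- Crossing edges with symmetric roles. -/
lemma nc_nocross' {n : ℕ} (θ : NCTree n) (a b c d : Fin n) (h1 : a < c) (h2 : c < b)
    (h3 : d < a ∨ b < d) (hab : θ.adj.Adj a b) (hcd : θ.adj.Adj c d) : False := by
  rcases h3 with h3 | h3
  · exact nc_nocross θ d a c b h3 h1 h2 hcd.symm hab
  · exact nc_nocross θ a c b d h1 h2 h3 hab hcd

lemma list_switch (Q : List ℕ → Prop) (v t : List ℕ) (hv : Q v) (ht : ¬ Q (v ++ t)) :
    ∃ x, v <+: x.dropLast ∧ x <+: v ++ t ∧ x ≠ [] ∧ Q x.dropLast ∧ ¬ Q x := by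
  induction t using List.reverseRecOn with
  | nil => simp at ht; exact absurd hv ht
  | append_singleton t i ih =>
    by_cases h : Q (v ++ t)
    · refine ⟨v ++ (t ++ [i]), ?_, List.prefix_rfl, by simp, ?_, ht⟩
      · rw [← List.append_assoc, List.dropLast_concat]; exact List.prefix_append _ _
      · rw [← List.append_assoc, List.dropLast_concat]; exact h
    · obtain ⟨x, h1, h2, h3⟩ := ih h
      exact ⟨x, h1, h2.trans (by simp), h3⟩

lemma list_lex (w u : List ℕ) (h : w < u) :
    w <+: u ∨ ∃ v i j, i < j ∧ v ++ [i] <+: w ∧ v ++ [j] <+: u := by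
  induction w generalizing u with
  | nil => left; simp
  | cons a w ih =>
    cases u with
    | nil => simp at h
    | cons b u =>
      rw [List.cons_lt_cons_iff] at h
      rcases h with h | ⟨rfl, h⟩
      · right; exact ⟨[], a, b, h, by simp, by simp⟩
      · rcases ih u h with h | ⟨v, i, j, hij, h1, h2⟩
        · left; simpa using h
        · right; exact ⟨a :: v, i, j, hij, by simpa using h1, by simpa using h2⟩

lemma nc_convex {n : ℕ} {θ : NCTree n} {τ : PlaneTree} {f : List ℕ → Fin n}
    (hs : IsShape n θ τ f) (v x y z : List ℕ) (hv : v ≠ [])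
    (hx : x ∈ τ.verts) (hy : y ∈ τ.verts) (hz : z ∈ τ.verts)
    (hvx : v <+: x) (hvy : v <+: y) (h1 : f x < f z) (h2 : f z < f y) : v <+: z := by
  obtain ⟨hcard, hbij, h0, hadj, -, -⟩ := hs
  by_contra hvz
  have hvm : v ∈ τ.verts := τ.prefix_closed _ _ hvx hx
  have hdl : ∀ u ∈ τ.verts, u.dropLast ∈ τ.verts :=
    fun u hu => τ.prefix_closed _ _ (List.dropLast_prefix u) hu
  have hne : ∀ u ∈ τ.verts, ∀ w ∈ τ.verts, v <+: u → ¬ v <+: w → f u ≠ f w := by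
    intro u hu w hw h1 h2 h
    exact h2 (hbij.injOn hu hw h ▸ h1)
  -- an edge inside the subtree of v that straddles z
  have hedge : ∃ p q, p ∈ τ.verts ∧ q ∈ τ.verts ∧ v <+: p ∧ v <+: q ∧ f p < f z ∧ f z < f q ∧
      θ.adj.Adj (f p) (f q) := by
    rcases lt_or_gt_of_ne (hne v hvm z hz List.prefix_rfl hvz) with h | h
    · obtain ⟨t, rfl⟩ := hvy
      obtain ⟨e, e1, e2, e3, e4, e5⟩ := list_switch (fun l => f l < f z) v t h (by simpa using h2.le)
      have he : e ∈ τ.verts := τ.prefix_closed _ _ e2 hy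
      have hve : v <+: e := e1.trans (List.dropLast_prefix e)
      exact ⟨e.dropLast, e, hdl e he, he, e1, hve, e4,
        lt_of_le_of_ne (not_lt.1 e5) (hne e he z hz hve hvz).symm, hadj e he e3⟩
    · obtain ⟨t, rfl⟩ := hvx
      obtain ⟨e, e1, e2, e3, e4, e5⟩ := list_switch (fun l => f z < f l) v t h (by simpa using h1.le)
      have he : e ∈ τ.verts := τ.prefix_closed _ _ e2 hx
      have hve : v <+: e := e1.trans (List.dropLast_prefix e)
      exact ⟨e, e.dropLast, he, hdl e he, hve, e1,
        lt_of_le_of_ne (not_lt.1 e5) (hne e he z hz hve hvz), e4, (hadj e he e3).symm⟩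
  obtain ⟨p, q, hp, hq, hvp, hvq, hpz, hzq, hpq⟩ := hedge
  obtain ⟨e, e1, e2, e3, e4, e5⟩ := list_switch (fun l => ¬ (f p < f l ∧ f l < f q)) [] z
    (by intro h; have := h.1; rw [Fin.lt_def, h0] at this; omega) (by simpa using ⟨hpz, hzq⟩)
  have e2 : e <+: z := e2
  have he : e ∈ τ.verts := τ.prefix_closed _ _ e2 hz
  have hve : ¬ v <+: e := fun h => hvz (h.trans e2)
  have hve' : ¬ v <+: e.dropLast := fun h => hve (h.trans (List.dropLast_prefix e))
  have e5 := not_not.1 e5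
  have n1 := hne p hp _ (hdl e he) hvp hve'
  have n2 := hne q hq _ (hdl e he) hvq hve'
  refine nc_nocross' θ (f p) (f q) (f e) (f e.dropLast) e5.1 e5.2 ?_ hpq (hadj e he e3).symm
  rcases lt_or_gt_of_ne n1 with h | h
  · right
    exact lt_of_le_of_ne (not_lt.1 fun h' => e4 ⟨h, h'⟩) n2
  · exact Or.inl h

lemma nc_child_lt {n : ℕ} {θ : NCTree n} {τ : PlaneTree} {f : List ℕ → Fin n}
    (hs : IsShape n θ τ f) (v : List ℕ) (i j : ℕ) (hij : i < j)
    (hi : v ++ [i] ∈ τ.verts) (hj : v ++ [j] ∈ τ.verts) : f (v ++ [i]) < f (v ++ [j]) := by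
  have hv : v ∈ τ.verts := τ.prefix_closed _ _ (List.prefix_append _ _) hi
  have hi1 : 1 ≤ i := τ.labels_pos _ hi i (by simp)
  have hlt := hs.2.2.2.2.2 v hv i j hi1 hij hj
  have hinj := hs.2.1.injOn
  by_contra hcon
  have hne : f (v ++ [i]) ≠ f (v ++ [j]) := by
    intro h
    have := hinj hi hj h
    simp at this; omega
  have hgt : f (v ++ [j]) < f (v ++ [i]) := lt_of_le_of_ne (not_lt.1 hcon) hne.symm
  have hp : ¬ (f (v ++ [j]) < f v.dropLast ∧ f v.dropLast ≤ f (v ++ [i])) := by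
    rintro ⟨h1, h2⟩
    by_cases hv0 : v = []
    · subst hv0
      have := hs.2.2.1
      simp only [List.dropLast_nil, Fin.lt_def] at h1; omega
    · have hd : v.dropLast ∈ τ.verts := τ.prefix_closed _ _ (List.dropLast_prefix v) hv
      have hlen : ¬ v <+: v.dropLast := by
        intro h
        have := h.length_le
        have := List.length_pos_iff.2 hv0
        simp at *; omega
      have h2' : f v.dropLast < f (v ++ [i]) := by
        refine lt_of_le_of_ne h2 fun h => ?_
        have := hinj hd hi h
        exact hlen (this ▸ List.prefix_append _ _)
      exact hlen (nc_convex hs v _ _ _ hv0 hj hi hd (List.prefix_append _ _)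
        (List.prefix_append _ _) h1 h2')
  generalize f (v ++ [i]) = a at *
  generalize f (v ++ [j]) = b at *
  generalize f v.dropLast = c at *
  rw [Fin.lt_def, Fin.val_sub, Fin.val_sub] at hlt
  rw [Fin.lt_def] at hgt
  rw [Fin.lt_def, Fin.le_def] at hp
  have ha := a.2
  have hb := b.2
  have hc := c.2
  by_cases hca : c.1 ≤ b.1
  · rw [show n - c.1 + a.1 = (a.1 - c.1) + n by omega,
      show n - c.1 + b.1 = (b.1 - c.1) + n by omega, Nat.add_mod_right, Nat.add_mod_right,
      Nat.mod_eq_of_lt (by omega), Nat.mod_eq_of_lt (by omega)] at hlt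
    omega
  · rw [Nat.mod_eq_of_lt (by omega), Nat.mod_eq_of_lt (by omega)] at hlt
    omega

lemma nc_order {n : ℕ} {θ : NCTree n} {τ : PlaneTree} {f : List ℕ → Fin n}
    (hs : IsShape n θ τ f) (x y : List ℕ) (hx : x ∈ τ.verts) (hy : y ∈ τ.verts)
    (hlt : x < y) (hpre : ¬ x <+: y) : f x < f y := by
  rcases list_lex x y hlt with h | ⟨v, i, j, hij, hix, hjy⟩
  · exact absurd h hpre
  have hi := τ.prefix_closed _ _ hix hx
  have hj := τ.prefix_closed _ _ hjy hy
  have hc := nc_child_lt hs v i j hij hi hj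
  have hdis : ∀ z, v ++ [i] <+: z → v ++ [j] <+: z → False := by
    intro z h1 h2
    have := List.prefix_of_prefix_length_le h1 h2 (by simp)
    have := this.eq_of_length (by simp)
    simp at this; omega
  have hinj := hs.2.1.injOn
  by_contra hcon
  have hyx : f y < f x := by
    refine lt_of_le_of_ne (not_lt.1 hcon) fun h => ?_
    have := hinj hy hx h
    subst this
    exact hdis _ hix hjy
  have hxj : f x < f (v ++ [j]) := by
    by_contra h
    have h : f (v ++ [j]) < f x := by
      refine lt_of_le_of_ne (not_lt.1 h) fun h => ?_
      have := hinj hj hx h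
      exact hdis x hix (this ▸ List.prefix_rfl)
    exact hdis _ (nc_convex hs (v ++ [i]) _ _ _ (by simp) hi hx hj List.prefix_rfl hix hc h)
      List.prefix_rfl
  exact hdis _ hix (nc_convex hs (v ++ [j]) _ _ _ (by simp) hy hj hx hjy List.prefix_rfl hyx hxj)

lemma lexVertex_spec (τ : PlaneTree) (k : ℕ) (hk : k < τ.verts.card) :
    τ.lexVertex k ∈ τ.verts ∧ (τ.verts.filter (· < τ.lexVertex k)).card = k := by
  have hlen : k < (τ.verts.sort (· ≤ ·)).length := by simpa using hk
  have hu : τ.lexVertex k = τ.verts.orderEmbOfFin rfl ⟨k, hk⟩ := by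
    unfold PlaneTree.lexVertex
    rw [List.getD_eq_getElem _ _ hlen]
    rfl
  refine ⟨by rw [hu]; exact Finset.orderEmbOfFin_mem _ _ _, ?_⟩
  have : τ.verts.filter (· < τ.lexVertex k) =
      (Finset.Iio (⟨k, hk⟩ : Fin τ.verts.card)).map (τ.verts.orderEmbOfFin rfl).toEmbedding := by
    ext w
    simp only [Finset.mem_filter, Finset.mem_map, Finset.mem_Iio, hu]
    constructor
    · rintro ⟨hw, hl⟩
      have : w ∈ Set.range (τ.verts.orderEmbOfFin rfl) := by
        rw [Finset.range_orderEmbOfFin]; exact hw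
      obtain ⟨m, rfl⟩ := this
      exact ⟨m, by simpa using hl, rfl⟩
    · rintro ⟨m, hm, rfl⟩
      exact ⟨Finset.orderEmbOfFin_mem _ _ _, by simpa using hm⟩
  rw [this, Finset.card_map]
  simp

/-- Let `θ` be a noncrossing tree with `n` vertices and shape `τ`, with
vertices `u_0 ≺ … ≺ u_{n-1}` of `τ` in lexicographical order. For `0 ≤ k ≤ n-1`, if `S_k` is
the number of strict descendants of `u_k` and `P_k` is such that the vertex of `θ`
corresponding to `u_k` is `e^{-2iπ P_k/n}`, then `|k - P_k| ≤ H(τ) + S_k`. -/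
theorem abs_lexIndex_sub_position_le (n : ℕ) (hn : 1 ≤ n) (θ : NCTree n) (τ : PlaneTree)
    (f : List ℕ → Fin n) (hshape : IsShape n θ τ f) (k : ℕ) (hk : k ≤ n - 1) :
    |(k : ℤ) - ((f (τ.lexVertex k) : Fin n) : ℤ)| ≤
      (τ.height : ℤ) + (τ.descCount (τ.lexVertex k) : ℤ) := by
  classical
  obtain ⟨hu, hcard⟩ := lexVertex_spec τ k (by rw [hshape.1]; omega)
  generalize τ.lexVertex k = u at *
  have hP : (τ.verts.filter (fun w => f w < f u)).card = (f u : ℕ) := by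
    have hb := hshape.2.1
    have : (τ.verts.filter (fun w => f w < f u)).image f = Finset.Iio (f u) := by
      ext a
      simp only [Finset.mem_image, Finset.mem_filter, Finset.mem_Iio]
      constructor
      · rintro ⟨w, ⟨_, h⟩, rfl⟩; exact h
      · intro h
        obtain ⟨w, hw, rfl⟩ := hb.surjOn (Set.mem_univ a)
        exact ⟨w, ⟨hw, h⟩, rfl⟩
    rw [← Finset.card_image_of_injOn (f := f), this]
    · simp
    · intro x hx y hy h
      simp at hx hy
      exact hb.injOn hx.1 hy.1 h
  have hS : (τ.verts.filter (fun w => u <+: w ∧ w ≠ u)).card = τ.descCount u := by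
    unfold PlaneTree.descCount
    rw [← Set.ncard_coe_finset]
    congr 1
    ext w
    simp
  have hH : u.length ≤ τ.height := Finset.le_sup (f := List.length) hu
  have b1 : (τ.verts.filter (· < u)).card ≤ (f u : ℕ) + u.length := by
    have hsub : τ.verts.filter (· < u) ⊆ τ.verts.filter (fun w => f w < f u) ∪
        (Finset.range u.length).image (fun m => u.take m) := by
      intro w hw
      simp only [Finset.mem_filter, Finset.mem_union, Finset.mem_image, Finset.mem_range] at hw ⊢
      by_cases hp : w <+: u
      · right
        refine ⟨w.length, ?_, (List.prefix_iff_eq_take.1 hp).symm⟩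
        refine lt_of_le_of_ne hp.length_le fun h => ?_
        have := hp.eq_of_length h
        subst this
        exact lt_irrefl _ hw.2
      · left
        exact ⟨hw.1, nc_order hshape w u hw.1 hu hw.2 hp⟩
    have h1 := Finset.card_le_card hsub
    have h2 := Finset.card_union_le (τ.verts.filter (fun w => f w < f u))
      ((Finset.range u.length).image (fun m => u.take m))
    have h3 := Finset.card_image_le (s := Finset.range u.length) (f := fun m => u.take m)
    rw [Finset.card_range] at h3
    omega
  have b2 : (f u : ℕ) ≤ (τ.verts.filter (· < u)).card + τ.descCount u := by
    have hsub : τ.verts.filter (fun w => f w < f u) ⊆ τ.verts.filter (· < u) ∪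
        τ.verts.filter (fun w => u <+: w ∧ w ≠ u) := by
      intro w hw
      simp only [Finset.mem_filter, Finset.mem_union] at hw ⊢
      rcases lt_trichotomy w u with h | h | h
      · exact Or.inl ⟨hw.1, h⟩
      · subst h; exact absurd hw.2 (lt_irrefl _)
      · right
        refine ⟨hw.1, ?_, h.ne'⟩
        by_contra hp
        exact absurd (nc_order hshape u w hu hw.1 h hp) hw.2.asymm
    have h1 := Finset.card_le_card hsub
    have h2 := Finset.card_union_le (τ.verts.filter (· < u))
      (τ.verts.filter (fun w => u <+: w ∧ w ≠ u))
    omega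
  rw [abs_le]
  omega
end
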